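/- Let k be a field, let F = x_n^d + Σ_{i=0}^{n−3} x_i G_i(x_0,…,x_n) with each G_i homogeneous of degree d−1, suppose X = V_+(F) ⊆ P^n is smooth over k, and let I be the ideal of P = k[z_{ij} : 0 ≤ i ≤ n, j = 0,1] defining the Segre product X × P^1 ⊆ P^{2n+1}. Then ara_h(I) = 2n−1. Furthermore, if k has characteristic 0, then ara(I) = ara_h(I) = 2n−1. -/

import Mathlib

/-!
STATEMENT 13: Let `k` be a field, let `F = xₙ^d + Σ_{i=0}^{n−3} xᵢ Gᵢ(x₀,…,xₙ)` with each
`Gᵢ` homogeneous of degree `d−1`, suppose `X = V₊(F) ⊆ ℙⁿ` is smooth over `k`, and let `I`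
be the ideal of `P = k[z_{ij} : 0 ≤ i ≤ n, j = 0,1]` defining the Segre product
`X × ℙ¹ ⊆ ℙ^{2n+1}`.  Then `ara_h(I) = 2n−1`.  Furthermore, if `k` has characteristic `0`,
then `ara(I) = ara_h(I) = 2n−1`.

Smoothness of the projective hypersurface `V₊(F)` is expressed by the Jacobian criterion
over the algebraic closure of `k`.
-/

open MvPolynomial

/-- The ideal of `P = k[z_{ij}]` defining the Segre product
`V₊(a) × V₊(b) ⊆ ℙ^{nm+n+m}`: the kernel of the map `z_{ij} ↦ x_i y_j (mod a,b)`. -/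
noncomputable def segreIdeal (k : Type*) [Field k] (n m : ℕ)
    (a : Ideal (MvPolynomial (Fin (n+1)) k)) (b : Ideal (MvPolynomial (Fin (m+1)) k)) :
    Ideal (MvPolynomial (Fin (n+1) × Fin (m+1)) k) :=
  RingHom.ker (MvPolynomial.aeval (R := k) (fun p : Fin (n+1) × Fin (m+1) =>
    Ideal.Quotient.mk
      (a.map (MvPolynomial.rename (Sum.inl : Fin (n+1) → Fin (n+1) ⊕ Fin (m+1)))
        ⊔ b.map (MvPolynomial.rename (Sum.inr : Fin (m+1) → Fin (n+1) ⊕ Fin (m+1))))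
      (X (Sum.inl p.1) * X (Sum.inr p.2))))

/-- arithmetical rank -/
noncomputable def ara {R : Type*} [CommRing R] (I : Ideal R) : ℕ :=
  sInf {t | ∃ f : Fin t → R, (Ideal.span (Set.range f)).radical = I.radical}

/-- homogeneous arithmetical rank -/
noncomputable def araH {k : Type*} [CommRing k] {σ : Type*} (I : Ideal (MvPolynomial σ k)) : ℕ :=
  sInf {t | ∃ f : Fin t → MvPolynomial σ k, (∀ i, ∃ d, (f i).IsHomogeneous d) ∧
    (Ideal.span (Set.range f)).radical = I.radical}

/-- smoothness of the projective hypersurface `V₊(F) ⊆ ℙⁿ` over a field `k`: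
the Jacobian criterion over the algebraic closure. -/
def IsSmoothHypersurface {k : Type*} [Field k] {n : ℕ}
    (F : MvPolynomial (Fin (n+1)) k) : Prop :=
  ∀ v : Fin (n+1) → AlgebraicClosure k, v ≠ 0 →
    ¬ (MvPolynomial.eval v (F.map (algebraMap k (AlgebraicClosure k))) = 0 ∧
       ∀ i, MvPolynomial.eval v
          ((MvPolynomial.pderiv i F).map (algebraMap k (AlgebraicClosure k))) = 0)

universe u

/-- The alternating coboundary of a cochain whose simplices are lists of indices. -/
def cobd {ι A : Type*} [AddCommGroup A] : (List ι → A) → List ι → A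
  | _, [] => 0
  | α, j :: I => α I - cobd (fun I' => α (j :: I')) I

section Cobd

variable {ι A B : Type*} [AddCommGroup A] [AddCommGroup B]

theorem cobd_map (f : A →+ B) (α : List ι → A) (I : List ι) :
    f (cobd α I) = cobd (fun I' => f (α I')) I := by
  induction I generalizing α with
  | nil => simp [cobd]
  | cons j I ih => simp [cobd, ih]

theorem cobd_sub (α β : List ι → A) (I : List ι) :
    cobd (fun I' => α I' - β I') I = cobd α I - cobd β I := by
  induction I generalizing α β with
  | nil => simp [cobd]
  | cons j I ih => simp only [cobd, ih]; abel

theorem cobd_cobd (α : List ι → A) (I : List ι) : cobd (cobd α) I = 0 := by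
  induction I generalizing α with
  | nil => simp [cobd]
  | cons j I ih => simp [cobd, cobd_sub, ih]

theorem cobd_mem [DecidableEq ι] (L : Finset ι → AddSubgroup A) (hL : Monotone L)
    (α : List ι → A) (r : ℕ) (h : ∀ I : List ι, I.length = r → α I ∈ L I.toFinset)
    (I : List ι) (hI : I.length = r + 1) : cobd α I ∈ L I.toFinset := by
  induction I generalizing α r L with
  | nil => simp at hI
  | cons j I ih =>
    have hI' : I.length = r := by simpa using hI
    have hle : L I.toFinset ≤ L (j :: I).toFinset :=
      hL (by simp [List.toFinset_cons, Finset.subset_insert])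
    refine sub_mem (hle (h I hI')) ?_
    rcases r with _ | r
    · rw [List.length_eq_zero_iff.mp hI']
      exact zero_mem _
    · have := ih (fun S => L (insert j S)) (fun S T hST => hL (Finset.insert_subset_insert j hST))
        (fun I' => α (j :: I')) r
        (fun I' hI'' => by simpa [List.toFinset_cons] using h (j :: I') (by simp [hI''])) hI'
      simpa [List.toFinset_cons] using this

theorem cobd_congr (α β : List ι → A) (r : ℕ)
    (h : ∀ I : List ι, I.length = r → α I = β I)
    (I : List ι) (hI : I.length = r + 1) : cobd α I = cobd β I := by
  classical
  have := cobd_mem (fun _ => (⊥ : AddSubgroup A)) (fun _ _ _ => le_rfl)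
    (fun I' => α I' - β I') r (fun I' hI' => by simp [h I' hI']) I hI
  rw [cobd_sub] at this
  simpa [sub_eq_zero] using this

end Cobd

section Loc

variable {ι R Λ : Type*} [CommRing R] [CommRing Λ]

/-- The elements of `Λ` that become elements of `𝔞` after multiplication by a power of
`∏ i ∈ S, x i`. -/
def loc (φ : R →+* Λ) (x : ι → R) (S : Finset ι) (𝔞 : Ideal R) : AddSubgroup Λ where
  carrier := {z | ∃ e : ℕ, ∃ a ∈ 𝔞, φ a = φ (∏ i ∈ S, x i) ^ e * z}
  zero_mem' := ⟨0, 0, zero_mem _, by simp⟩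
  add_mem' := by
    rintro z w ⟨e, a, ha, h⟩ ⟨e', a', ha', h'⟩
    refine ⟨e + e', (∏ i ∈ S, x i) ^ e' * a + (∏ i ∈ S, x i) ^ e * a',
      add_mem (𝔞.mul_mem_left _ ha) (𝔞.mul_mem_left _ ha'), ?_⟩
    simp only [map_add, map_mul, map_pow, h, h']
    ring
  neg_mem' := by
    rintro z ⟨e, a, ha, h⟩
    exact ⟨e, -a, neg_mem ha, by rw [map_neg, h, mul_neg]⟩

variable {φ : R →+* Λ} {x : ι → R}

theorem loc_mono_right {S : Finset ι} {𝔞 𝔟 : Ideal R} (h : 𝔞 ≤ 𝔟) :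
    loc φ x S 𝔞 ≤ loc φ x S 𝔟 := by
  rintro z ⟨e, a, ha, hz⟩
  exact ⟨e, a, h ha, hz⟩

theorem loc_mono_left (𝔞 : Ideal R) : Monotone (fun S : Finset ι => loc φ x S 𝔞) := by
  classical
  rintro S T hST z ⟨e, a, ha, hz⟩
  refine ⟨e, (∏ i ∈ T \ S, x i) ^ e * a, 𝔞.mul_mem_left _ ha, ?_⟩
  rw [← Finset.prod_sdiff hST, map_mul, map_mul, hz, map_pow]
  ring

theorem map_mem_loc (S : Finset ι) {𝔞 : Ideal R} {a : R} (ha : a ∈ 𝔞) : φ a ∈ loc φ x S 𝔞 :=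
  ⟨0, a, ha, by simp⟩

theorem mul_mem_loc {S : Finset ι} {𝔞 𝔟 : Ideal R} {z w : Λ} (hz : z ∈ loc φ x S 𝔞)
    (hw : w ∈ loc φ x S 𝔟) : z * w ∈ loc φ x S (𝔞 * 𝔟) := by
  obtain ⟨e, a, ha, h⟩ := hz
  obtain ⟨e', a', ha', h'⟩ := hw
  refine ⟨e + e', a * a', Ideal.mul_mem_mul ha ha', ?_⟩
  rw [map_mul, h, h']
  ring

theorem mul_mem_loc_left {S : Finset ι} {𝔞 : Ideal R} {z w : Λ} (hz : z ∈ loc φ x S 𝔞)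
    (hw : w ∈ loc φ x S ⊤) : z * w ∈ loc φ x S 𝔞 := by
  simpa using mul_mem_loc hz hw

theorem mul_mem_loc_right {S : Finset ι} {𝔞 : Ideal R} {z w : Λ} (hz : z ∈ loc φ x S ⊤)
    (hw : w ∈ loc φ x S 𝔞) : z * w ∈ loc φ x S 𝔞 := by
  simpa using mul_mem_loc hz hw

theorem one_mem_loc (S : Finset ι) : (1 : Λ) ∈ loc φ x S ⊤ := by
  simpa using map_mem_loc (φ := φ) (x := x) S (Submodule.mem_top (x := (1 : R)))

theorem mem_loc_of_mul_eq_one {S : Finset ι} {i : ι} (hi : i ∈ S) {z : Λ}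
    (h : φ (x i) * z = 1) : z ∈ loc φ x S ⊤ := by
  classical
  refine ⟨1, ∏ j ∈ S.erase i, x j, Submodule.mem_top, ?_⟩
  rw [← Finset.mul_prod_erase S x hi, map_mul, pow_one, mul_right_comm, h, one_mul]

theorem exists_loc_lift {R' Λ' : Type*} [CommRing R'] [CommRing Λ'] {φ' : R' →+* Λ'}
    {x' : ι → R'} (π : R' →+* R) (Φ : Λ' →+* Λ) (hΦ : ∀ a, Φ (φ' a) = φ (π a))
    (hx : ∀ i, π (x' i) = x i) (hu : ∀ i, IsUnit (φ' (x' i))) (hπ : Function.Surjective π)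
    {S : Finset ι} {𝔞' : Ideal R'} {z : Λ} (hz : z ∈ loc φ x S (𝔞'.map π)) :
    ∃ z' ∈ loc φ' x' S 𝔞', Φ z' = z := by
  obtain ⟨e, a, ha, h⟩ := hz
  obtain ⟨a', ha', rfl⟩ := (Ideal.mem_map_iff_of_surjective π hπ).mp ha
  have hU : IsUnit (φ' (∏ i ∈ S, x' i) ^ e) := by
    rw [map_prod]
    exact (IsUnit.prod_iff.mpr fun i _ => hu i).pow e
  obtain ⟨u, hu'⟩ := hU
  refine ⟨φ' a' * ↑u⁻¹, ⟨e, a', ha', ?_⟩, ?_⟩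
  · rw [← hu', mul_left_comm, Units.mul_inv, mul_one]
  · have hΦu : Φ u = φ (∏ i ∈ S, x i) ^ e := by
      rw [hu', map_pow, hΦ]; simp [map_prod, hx]
    rw [map_mul, hΦ, h, mul_right_comm, ← hΦu, ← map_mul, Units.mul_inv, map_one, one_mul]

theorem map_loc {R' Λ' : Type*} [CommRing R'] [CommRing Λ'] {φ' : R' →+* Λ'}
    {x' : ι → R'} (π : R' →+* R) (Φ : Λ' →+* Λ) (hΦ : ∀ a, Φ (φ' a) = φ (π a))
    (hx : ∀ i, π (x' i) = x i) {S : Finset ι} {𝔞' : Ideal R'} {z : Λ'}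
    (hz : z ∈ loc φ' x' S 𝔞') : Φ z ∈ loc φ x S (𝔞'.map π) := by
  obtain ⟨e, a, ha, h⟩ := hz
  refine ⟨e, π a, Ideal.mem_map_of_mem π ha, ?_⟩
  rw [← hΦ, h, map_mul, map_pow, hΦ, map_prod]
  simp [hx]

theorem exists_eq_mul_of_mem_loc {R' Λ' : Type*} [CommRing R'] [CommRing Λ'] {φ' : R' →+* Λ'}
    {x' : ι → R'} (π : R' →+* R) (Φ : Λ' →+* Λ) (hΦ : ∀ a, Φ (φ' a) = φ (π a))
    (hu : ∀ i, IsUnit (φ' (x' i))) (hφ : Function.Injective φ) {g : R'}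
    (hg : RingHom.ker π = Ideal.span {g}) [IsNoetherianRing R'] (J' : Ideal R') :
    ∃ c, ∀ (S : Finset ι) (k : ℕ) (z : Λ'), Φ z = 0 → z ∈ loc φ' x' S (J' ^ k) →
      ∃ y ∈ loc φ' x' S (J' ^ (k - c)), z = φ' g * y := by
  obtain ⟨c, hc⟩ := Ideal.exists_pow_inf_eq_pow_smul J' (Ideal.span {g})
  refine ⟨c, fun S k z hz ⟨e, a, ha, h⟩ => ?_⟩
  have hπa : π a = 0 := hφ (by rw [← hΦ, h, map_mul, hz, mul_zero, map_zero])
  have hag : a ∈ Ideal.span {g} := by rw [← hg]; exact hπa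
  obtain ⟨b, hb, hab⟩ : ∃ b ∈ J' ^ (k - c), g * b = a := by
    rcases le_or_gt c k with hck | hck
    · have h1 : a ∈ J' ^ k • (⊤ : Ideal R') ⊓ Ideal.span {g} := by
        refine ⟨?_, hag⟩
        simpa using ha
      rw [hc k hck] at h1
      have h2 : a ∈ J' ^ (k - c) * Ideal.span {g} :=
        Ideal.mul_mono_right inf_le_right h1
      obtain ⟨b, hb, rfl⟩ := Ideal.mem_mul_span_singleton.mp h2
      exact ⟨b, hb, mul_comm _ _⟩
    · obtain ⟨b, rfl⟩ := Ideal.mem_span_singleton.mp hag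
      exact ⟨b, by simp [Nat.sub_eq_zero_of_le hck.le], rfl⟩
  have hU : IsUnit (φ' (∏ i ∈ S, x' i) ^ e) := by
    rw [map_prod]
    exact (IsUnit.prod_iff.mpr fun i _ => hu i).pow e
  obtain ⟨u, hu'⟩ := hU
  refine ⟨φ' b * ↑u⁻¹, ⟨e, b, hb, ?_⟩, ?_⟩
  · rw [← hu', mul_left_comm, Units.mul_inv, mul_one]
  · rw [← mul_assoc, ← map_mul, hab, h, ← hu', mul_right_comm, Units.mul_inv, one_mul]

end Loc

/-- Cochains in degree `m` whose values lie in a power of `J` and whose coboundary lies in a higher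
power of `J` are coboundaries up to that higher power, with a bounded loss of exponents. -/
def UniformlyExact {ι R Λ : Type*} [DecidableEq ι] [CommRing R] [CommRing Λ] (φ : R →+* Λ)
    (x : ι → R) (J : Ideal R) (m : ℕ) : Prop :=
  ∃ c : ℕ, ∀ (M k : ℕ) (α : List ι → Λ),
    (∀ I : List ι, I.length = m + 1 → α I ∈ loc φ x I.toFinset (J ^ M)) →
    (∀ I : List ι, I.length = m + 2 → cobd α I ∈ loc φ x I.toFinset (J ^ k)) →
    ∃ ε : List ι → Λ,
      (∀ I : List ι, I.length = m → ε I ∈ loc φ x I.toFinset (J ^ (M - c))) ∧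
      (∀ I : List ι, I.length = m + 1 → α I - cobd ε I ∈ loc φ x I.toFinset (J ^ (k - c)))

theorem uniformlyExact_of_ker_eq_span {ι R Λ R' Λ' : Type*} [DecidableEq ι]
    [CommRing R] [CommRing Λ] [CommRing R'] [CommRing Λ'] [IsNoetherianRing R']
    {φ : R →+* Λ} {x : ι → R} {φ' : R' →+* Λ'} {x' : ι → R'}
    (π : R' →+* R) (Φ : Λ' →+* Λ) (hΦ : ∀ a, Φ (φ' a) = φ (π a))
    (hx : ∀ i, π (x' i) = x i) (hu : ∀ i, IsUnit (φ' (x' i))) (hπ : Function.Surjective π)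
    (hφ : Function.Injective φ) {g : R'} (hg : RingHom.ker π = Ideal.span {g})
    (hreg : ∀ y, φ' g * y = 0 → y = 0) {J' : Ideal R'} {J : Ideal R} (hJ : J'.map π = J) {m : ℕ}
    (h₀ : UniformlyExact φ' x' J' m) (h₁ : UniformlyExact φ' x' J' (m + 1)) :
    UniformlyExact φ x J m := by
  obtain ⟨c₀, h₀⟩ := h₀
  obtain ⟨c₁, h₁⟩ := h₁
  obtain ⟨c, hc⟩ := exists_eq_mul_of_mem_loc (x' := x') π Φ hΦ hu hφ hg J'
  have hJp : ∀ k, J ^ k = (J' ^ k).map π := fun k => by rw [Ideal.map_pow, hJ]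
  suffices H : ∀ (M k : ℕ) (α : List ι → Λ), M ≤ k →
      (∀ I : List ι, I.length = m + 1 → α I ∈ loc φ x I.toFinset (J ^ M)) →
      (∀ I : List ι, I.length = m + 2 → cobd α I ∈ loc φ x I.toFinset (J ^ k)) →
      ∃ ε : List ι → Λ,
        (∀ I : List ι, I.length = m → ε I ∈ loc φ x I.toFinset (J ^ (M - (c + c₁ + c₀)))) ∧
        (∀ I : List ι, I.length = m + 1 →
          α I - cobd ε I ∈ loc φ x I.toFinset (J ^ (k - (c + c₁ + c₀)))) by
    refine ⟨c + c₁ + c₀, fun M k α hα hdα => ?_⟩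
    rcases le_total M k with hMk | hMk
    · exact H M k α hMk hα hdα
    · obtain ⟨ε, hε, hε'⟩ := H M M α le_rfl hα
        (cobd_mem (fun S => loc φ x S (J ^ M)) (loc_mono_left _) α (m + 1) hα)
      exact ⟨ε, hε, fun I hI => loc_mono_right (Ideal.pow_le_pow_right (by omega)) (hε' I hI)⟩
  intro M k α hMk hα hdα
  have hmono : ∀ {a b : ℕ} {S : Finset ι} {z : Λ'}, b ≤ a → z ∈ loc φ' x' S (J' ^ a) →
      z ∈ loc φ' x' S (J' ^ b) := fun h hz => loc_mono_right (Ideal.pow_le_pow_right h) hz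
  have lift : ∀ (r j : ℕ) (β : List ι → Λ),
      (∀ I : List ι, I.length = r → β I ∈ loc φ x I.toFinset (J ^ j)) →
      ∃ β' : List ι → Λ', ∀ I : List ι, I.length = r →
        β' I ∈ loc φ' x' I.toFinset (J' ^ j) ∧ Φ (β' I) = β I := by
    intro r j β hβ
    have : ∀ I : List ι, ∃ b : Λ', I.length = r →
        b ∈ loc φ' x' I.toFinset (J' ^ j) ∧ Φ b = β I := by
      intro I
      by_cases hI : I.length = r
      · obtain ⟨z', hz', h⟩ := exists_loc_lift π Φ hΦ hx hu hπ (hJp j ▸ hβ I hI)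
        exact ⟨z', fun _ => ⟨hz', h⟩⟩
      · exact ⟨0, fun h => absurd h hI⟩
    choose β' hβ' using this
    exact ⟨β', hβ'⟩
  have divide : ∀ (r j : ℕ) (β : List ι → Λ'),
      (∀ I : List ι, I.length = r → β I ∈ loc φ' x' I.toFinset (J' ^ j) ∧ Φ (β I) = 0) →
      ∃ γ : List ι → Λ', ∀ I : List ι, I.length = r →
        γ I ∈ loc φ' x' I.toFinset (J' ^ (j - c)) ∧ β I = φ' g * γ I := by
    intro r j β hβ
    have : ∀ I : List ι, ∃ b : Λ', I.length = r →
        b ∈ loc φ' x' I.toFinset (J' ^ (j - c)) ∧ β I = φ' g * b := by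
      intro I
      by_cases hI : I.length = r
      · obtain ⟨y, hy, h⟩ := hc _ _ _ (hβ I hI).2 (hβ I hI).1
        exact ⟨y, fun _ => ⟨hy, h⟩⟩
      · exact ⟨0, fun h => absurd h hI⟩
    choose γ hγ using this
    exact ⟨γ, hγ⟩
  have hmul : ∀ (β : List ι → Λ') (I : List ι),
      cobd (fun I' => φ' g * β I') I = φ' g * cobd β I :=
    fun β I => (cobd_map (AddMonoidHom.mulLeft (φ' g)) β I).symm
  have hΦd : ∀ (r : ℕ) (β : List ι → Λ') (β₀ : List ι → Λ),
      (∀ I : List ι, I.length = r → Φ (β I) = β₀ I) →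
      ∀ I : List ι, I.length = r + 1 → Φ (cobd β I) = cobd β₀ I := by
    intro r β β₀ h I hI
    exact (cobd_map (Φ : Λ' →+ Λ) β I).trans (cobd_congr _ _ r h I hI)
  obtain ⟨α', hα'⟩ := lift (m + 1) M α hα
  obtain ⟨κ, hκ⟩ := lift (m + 2) k (cobd α) hdα
  obtain ⟨γ, hγ⟩ := divide (m + 2) M (fun I => cobd α' I - κ I) (fun I hI => by
    refine ⟨sub_mem ?_ (hmono hMk (hκ I hI).1), ?_⟩
    · exact cobd_mem (fun S => loc φ' x' S (J' ^ M)) (loc_mono_left _) α' (m + 1)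
        (fun I hI => (hα' I hI).1) I hI
    · rw [map_sub, (hκ I hI).2, hΦd (m + 1) α' α (fun I hI => (hα' I hI).2) I hI, sub_self])
  obtain ⟨y, hy⟩ := divide (m + 3) k (cobd κ) (fun I hI => by
    refine ⟨cobd_mem (fun S => loc φ' x' S (J' ^ k)) (loc_mono_left _) κ (m + 2)
        (fun I hI => (hκ I hI).1) I hI, ?_⟩
    rw [hΦd (m + 2) κ (cobd α) (fun I hI => (hκ I hI).2) I hI, cobd_cobd])
  have hdγ : ∀ I : List ι, I.length = m + 3 →
      cobd γ I ∈ loc φ' x' I.toFinset (J' ^ (k - c)) := by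
    intro I hI
    have h1 : φ' g * cobd γ I = - (φ' g * y I) := by
      rw [← hmul, ← (hy I hI).2, ← cobd_congr _ _ (m + 2) (fun I hI => (hγ I hI).2) I hI, cobd_sub,
        cobd_cobd, zero_sub]
    have h2 : cobd γ I = - y I := by
      rw [← add_eq_zero_iff_eq_neg]
      exact hreg _ (by rw [mul_add, h1, neg_add_cancel])
    rw [h2]
    exact neg_mem (hy I hI).1
  obtain ⟨δ, hδ, hδ'⟩ := h₁ (M - c) (k - c) γ (fun I hI => (hγ I hI).1) hdγ
  have hgtop : ∀ S : Finset ι, φ' g ∈ loc φ' x' S ⊤ := fun S => map_mem_loc S Submodule.mem_top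
  have hΦg : Φ (φ' g) = 0 := by
    have : g ∈ RingHom.ker π := hg ▸ Ideal.mem_span_singleton_self g
    rw [hΦ, (RingHom.mem_ker).mp this, map_zero]
  obtain ⟨ε, hε, hε'⟩ := h₀ (M - c - c₁) (k - c - c₁) (fun I => α' I - φ' g * δ I)
    (fun I hI => sub_mem (hmono (by omega) (hα' I hI).1) (mul_mem_loc_right (hgtop _) (hδ I hI)))
    (fun I hI => by
      rw [cobd_sub, hmul]
      have : cobd α' I - φ' g * cobd δ I = κ I + φ' g * (γ I - cobd δ I) := by
        rw [mul_sub, ← (hγ I hI).2]; ring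
      rw [this]
      exact add_mem (hmono (by omega) (hκ I hI).1) (mul_mem_loc_right (hgtop _) (hδ' I hI)))
  refine ⟨fun I => Φ (ε I), fun I hI => ?_, fun I hI => ?_⟩
  · rw [hJp]
    exact map_loc π Φ hΦ hx (hmono (by omega) (hε I hI))
  · have : α I - cobd (fun I => Φ (ε I)) I = Φ (α' I - φ' g * δ I - cobd ε I) := by
      rw [map_sub, map_sub, map_mul, hΦg, (hα' I hI).2, hΦd m ε _ (fun I hI => rfl) I hI]
      ring
    rw [this, hJp]
    exact map_loc π Φ hΦ hx (hmono (by omega) (hε' I hI))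

section Laurent

variable {ι O : Type*} [CommRing O]

/-- Nonnegative integer exponents as integer exponents. -/
def expCast (ι : Type*) : (ι →₀ ℕ) →+ (ι → ℤ) where
  toFun s := fun i => (s i : ℤ)
  map_zero' := by ext; simp
  map_add' s t := by ext; simp

theorem expCast_apply (s : ι →₀ ℕ) (i : ι) : expCast ι s i = (s i : ℤ) := rfl

theorem expCast_injective : Function.Injective (expCast ι) := fun s t h => by
  ext i
  exact Int.ofNat_inj.mp (congrFun h i)

/-- The inclusion of the polynomial ring into the ring of Laurent polynomials. -/
noncomputable def toLaurent (ι O : Type*) [CommRing O] :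
    MvPolynomial ι O →+* AddMonoidAlgebra O (ι → ℤ) :=
  AddMonoidAlgebra.mapDomainRingHom O (expCast ι)

theorem toLaurent_monomial (s : ι →₀ ℕ) (c : O) :
    toLaurent ι O (monomial s c) = AddMonoidAlgebra.single (expCast ι s) c :=
  AddMonoidAlgebra.mapDomain_single

theorem toLaurent_C (c : O) : toLaurent ι O (C c) = AddMonoidAlgebra.single 0 c := by
  rw [C_apply, toLaurent_monomial, map_zero]

theorem toLaurent_X [DecidableEq ι] (i : ι) :
    toLaurent ι O (X i) = AddMonoidAlgebra.single (Pi.single i 1) 1 := by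
  rw [X, toLaurent_monomial]
  congr 1
  ext j
  simp [expCast_apply, Finsupp.single_apply, Pi.single_apply, eq_comm]

theorem toLaurent_injective : Function.Injective (toLaurent ι O) :=
  AddMonoidAlgebra.mapDomain_injective expCast_injective

theorem coeff_toLaurent (p : MvPolynomial ι O) (s : ι →₀ ℕ) :
    (toLaurent ι O p).coeff (expCast ι s) = p.coeff s :=
  Finsupp.mapDomain_apply expCast_injective _ _

theorem coeff_toLaurent_of_neg (p : MvPolynomial ι O) {a : ι → ℤ} {i : ι} (h : a i < 0) :
    (toLaurent ι O p).coeff a = 0 := by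
  refine Finsupp.mapDomain_of_notMem_range _ _ ?_
  rintro ⟨s, rfl⟩
  rw [expCast_apply] at h
  omega

theorem isUnit_toLaurent_X (i : ι) : IsUnit (toLaurent ι O (X i)) := by
  classical
  refine IsUnit.of_mul_eq_one (AddMonoidAlgebra.single (-Pi.single i 1) 1) ?_
  rw [toLaurent_X, AddMonoidAlgebra.single_mul_single, add_neg_cancel, one_mul]
  rfl

theorem toLaurent_prod_X_pow [DecidableEq ι] (S : Finset ι) (e : ℕ) :
    toLaurent ι O (∏ i ∈ S, X i) ^ e =
      AddMonoidAlgebra.single (fun i => if i ∈ S then (e : ℤ) else 0) 1 := by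
  have h : (∏ i ∈ S, X i : MvPolynomial ι O) ^ e
      = monomial (∑ i ∈ S, Finsupp.single i e) 1 := by
    rw [monomial_sum_one, ← Finset.prod_pow]
    exact Finset.prod_congr rfl fun i _ => by rw [X_pow_eq_monomial]
  rw [← map_pow, h, toLaurent_monomial]
  congr 1
  ext i
  simp [expCast_apply, Finsupp.finsetSum_apply, Finsupp.single_apply]

theorem exists_expCast_eq [Finite ι] {a : ι → ℤ} (h : ∀ i, 0 ≤ a i) : ∃ s, expCast ι s = a := by
  refine ⟨Finsupp.equivFunOnFinite.symm fun i => (a i).toNat, ?_⟩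
  ext i
  simp [expCast_apply, h i]

theorem AddMonoidAlgebra.sum_single_coeff {M : Type*} (z : AddMonoidAlgebra O M) :
    ∑ a ∈ z.coeff.support, AddMonoidAlgebra.single a (z.coeff a) = z := by
  ext b
  simp only [AddMonoidAlgebra.coeff_sum, AddMonoidAlgebra.coeff_single, Finsupp.finsetSum_apply]
  rw [Finset.sum_eq_single b]
  · simp
  · intro a _ hab
    simp [hab]
  · intro hb
    simpa using hb

theorem mem_loc_map_C_iff [Finite ι] (S : Finset ι) (𝔟 : Ideal O)
    (z : AddMonoidAlgebra O (ι → ℤ)) :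
    z ∈ loc (toLaurent ι O) X S (𝔟.map C) ↔
      ∀ a, z.coeff a ∈ 𝔟 ∧ (z.coeff a ≠ 0 → ∀ i ∉ S, 0 ≤ a i) := by
  classical
  constructor
  · rintro ⟨e, p, hp, h⟩ a
    rw [toLaurent_prod_X_pow] at h
    set v : ι → ℤ := fun i => if i ∈ S then (e : ℤ) else 0 with hv
    have hz : z.coeff a = (toLaurent ι O p).coeff (v + a) := by
      rw [h]
      simp
    by_cases hneg : ∃ i, (v + a) i < 0
    · obtain ⟨i, hi⟩ := hneg
      rw [hz, coeff_toLaurent_of_neg p hi]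
      simp
    · push Not at hneg
      refine ⟨?_, fun _ i hi => by simpa [hv, hi] using hneg i⟩
      obtain ⟨s, hs⟩ := exists_expCast_eq hneg
      rw [hz, ← hs, coeff_toLaurent]
      exact mem_map_C_iff.mp hp s
  · intro h
    rw [← AddMonoidAlgebra.sum_single_coeff z]
    refine sum_mem fun a ha => ?_
    have := Fintype.ofFinite ι
    have hnn : ∀ i, 0 ≤ ((fun i => if i ∈ S then ((∑ j, (a j).natAbs : ℕ) : ℤ) else 0) + a) i := by
      intro i
      by_cases hi : i ∈ S
      · have := Finset.single_le_sum (f := fun j => (a j).natAbs) (fun _ _ => Nat.zero_le _)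
          (Finset.mem_univ i)
        simp only [Pi.add_apply, hi, if_true]
        omega
      · simpa [hi] using (h a).2 (by simpa using ha) i hi
    obtain ⟨s, hs⟩ := exists_expCast_eq hnn
    refine ⟨∑ j, (a j).natAbs, monomial s (z.coeff a), ?_, ?_⟩
    · rw [mem_map_C_iff]
      intro t
      rw [coeff_monomial]
      split_ifs
      · exact (h a).1
      · exact zero_mem _
    · rw [toLaurent_prod_X_pow, toLaurent_monomial, hs, AddMonoidAlgebra.single_mul_single, one_mul]

theorem uniformlyExact_map_C [Fintype ι] [DecidableEq ι] (𝔬 : Ideal O) (m : ℕ)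
    (hm : m + 2 ≤ Fintype.card ι) :
    UniformlyExact (toLaurent ι O) X (𝔬.map (C : O →+* MvPolynomial ι O)) m := by
  classical
  have hJ : ∀ k, (𝔬.map (C : O →+* MvPolynomial ι O)) ^ k = (𝔬 ^ k).map C :=
    fun k => (Ideal.map_pow _ _ _).symm
  refine ⟨0, fun M k α hα hdα => ?_⟩
  simp only [hJ, mem_loc_map_C_iff, Nat.sub_zero] at hα hdα ⊢
  let pick : (ι → ℤ) → Option ι := fun a =>
    if h : ∃ i, 0 ≤ a i then some h.choose else none
  have hpick : ∀ a j, pick a = some j → 0 ≤ a j := by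
    intro a j h
    simp only [pick] at h
    split_ifs at h with h'
    rw [← Option.some_inj.mp h]
    exact h'.choose_spec
  have hpick' : ∀ a, pick a = none → ∀ i, a i < 0 := by
    intro a h i
    simp only [pick] at h
    split_ifs at h with h'
    push Not at h'
    exact h' i
  let co (a : ι → ℤ) : AddMonoidAlgebra O (ι → ℤ) →+ O :=
    { toFun := fun z => z.coeff a, map_zero' := by simp, map_add' := by simp }
  have hco : ∀ a z, co a z = z.coeff a := fun _ _ => rfl
  let ε : List ι → AddMonoidAlgebra O (ι → ℤ) := fun I =>
    ∑ j, AddMonoidAlgebra.ofCoeff ((α (j :: I)).coeff.filter fun a => pick a = some j)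
  have hε : ∀ I a, (ε I).coeff a =
      match pick a with
      | some j => (α (j :: I)).coeff a
      | none => 0 := by
    intro I a
    simp only [ε, AddMonoidAlgebra.coeff_sum, Finsupp.finsetSum_apply, Finsupp.filter_apply]
    cases h : pick a with
    | none => simp
    | some j => simp
  have hdε : ∀ I a, (cobd ε I).coeff a =
      match pick a with
      | some j => (α I).coeff a - (cobd α (j :: I)).coeff a
      | none => 0 := by
    intro I a
    rw [← hco, cobd_map]
    simp only [hco, hε]
    cases h : pick a with
    | none =>
      have := cobd_map (0 : O →+ O) (fun _ => 0) I
      simpa using this.symm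
    | some j =>
      simp only [← hco a, ← cobd_map]
      rw [← map_sub]
      simp [cobd]
  refine ⟨ε, fun I hI a => ?_, fun I hI a => ?_⟩
  · rw [hε]
    cases h : pick a with
    | none => simp
    | some j =>
      refine ⟨(hα (j :: I) (by simp [hI]) a).1, fun hne i hi => ?_⟩
      by_cases hij : i = j
      · exact hij ▸ hpick a j h
      · exact (hα (j :: I) (by simp [hI]) a).2 hne i (by simpa [hij] using hi)
  · rw [AddMonoidAlgebra.coeff_sub, Finsupp.sub_apply, hdε]
    cases h : pick a with
    | none =>
      have h0 : (α I).coeff a = 0 := by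
        by_contra hne
        have hsub : (Finset.univ : Finset ι) ⊆ I.toFinset := fun i _ => by
          by_contra hi
          exact absurd ((hα I hI a).2 hne i hi) (not_le.mpr (hpick' a h i))
        have h1 := (Finset.card_le_card hsub).trans I.toFinset_card_le
        rw [Finset.card_univ] at h1
        omega
      simp [h0]
    | some j =>
      simp only [sub_sub_cancel]
      refine ⟨(hdα (j :: I) (by simp [hI]) a).1, fun hne i hi => ?_⟩
      by_cases hij : i = j
      · exact hij ▸ hpick a j h
      · exact (hdα (j :: I) (by simp [hI]) a).2 hne i (by simpa [hij] using hi)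

end Laurent

section Step

variable {ι O : Type*} [CommRing O]

/-- Substitution of `g` for the variable of the coefficient ring. -/
noncomputable def substPoly (g : MvPolynomial ι O) :
    MvPolynomial ι (Polynomial O) →+* MvPolynomial ι O :=
  eval₂Hom (Polynomial.eval₂RingHom C g) X

theorem substPoly_X (g : MvPolynomial ι O) (i : ι) : substPoly g (X i) = X i := by
  simp [substPoly]

theorem substPoly_map_C (g p : MvPolynomial ι O) : substPoly g (map Polynomial.C p) = p := by
  induction p using MvPolynomial.induction_on with
  | C c => simp [substPoly]
  | add p q hp hq => simp [hp, hq]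
  | mul_X p i hp => rw [map_mul, map_mul, hp, map_X, substPoly_X]

theorem substPoly_C_X (g : MvPolynomial ι O) : substPoly g (C Polynomial.X) = g := by
  simp [substPoly]

theorem substPoly_C_C (g : MvPolynomial ι O) (c : O) :
    substPoly g (C (Polynomial.C c)) = C c := by
  simp [substPoly]

theorem ker_substPoly (g : MvPolynomial ι O) :
    RingHom.ker (substPoly g) = Ideal.span {C Polynomial.X - map Polynomial.C g} := by
  set G : MvPolynomial ι (Polynomial O) := C Polynomial.X - map Polynomial.C g
  apply le_antisymm
  · intro p hp
    have key : (Ideal.Quotient.mk (Ideal.span {G})).comp ((map Polynomial.C).comp (substPoly g)) =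
        Ideal.Quotient.mk (Ideal.span {G}) := by
      apply MvPolynomial.ringHom_ext'
      · apply Polynomial.ringHom_ext
        · intro c
          simp only [RingHom.comp_apply, substPoly_C_C, map_C]
        · simp only [RingHom.comp_apply, substPoly_C_X]
          exact (Ideal.Quotient.mk_eq_mk_iff_sub_mem _ _).mpr (by
            rw [← neg_mem_iff, neg_sub]
            exact Ideal.mem_span_singleton_self G)
      · intro i
        simp only [RingHom.comp_apply, substPoly_X, map_X]
    have h := RingHom.congr_fun key p
    simp only [RingHom.comp_apply, (RingHom.mem_ker).mp hp, map_zero] at h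
    exact Ideal.Quotient.eq_zero_iff_mem.mp h.symm
  · rw [Ideal.span_singleton_le_iff_mem, RingHom.mem_ker, map_sub, substPoly_C_X, substPoly_map_C,
      sub_self]

/-- Substitution of `g` for the variable of the coefficient ring in Laurent polynomials. -/
noncomputable def substLaurent (g : MvPolynomial ι O) :
    AddMonoidAlgebra (Polynomial O) (ι → ℤ) →+* AddMonoidAlgebra O (ι → ℤ) :=
  AddMonoidAlgebra.liftNCRingHom
    ((toLaurent ι O).comp (Polynomial.eval₂RingHom C g))
    (AddMonoidAlgebra.of O (ι → ℤ)) (fun _ _ => Commute.all _ _)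

theorem substLaurent_toLaurent (g : MvPolynomial ι O) (p : MvPolynomial ι (Polynomial O)) :
    substLaurent g (toLaurent ι (Polynomial O) p) = toLaurent ι O (substPoly g p) := by
  classical
  have hsingle : ∀ a c, substLaurent g (AddMonoidAlgebra.single a c) =
      toLaurent ι O (Polynomial.eval₂RingHom C g c) * AddMonoidAlgebra.single a 1 := by
    intro a c
    exact AddMonoidAlgebra.liftNC_single _ _ _ _
  have key : (substLaurent g).comp (toLaurent ι (Polynomial O)) =
      (toLaurent ι O).comp (substPoly g) := by
    apply MvPolynomial.ringHom_ext
    · intro c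
      simp only [RingHom.comp_apply, toLaurent_C, hsingle, substPoly, coe_eval₂Hom, eval₂_C]
      exact mul_one _
    · intro i
      simp only [RingHom.comp_apply, toLaurent_X, hsingle, substPoly_X, map_one, one_mul]
  exact RingHom.congr_fun key p

theorem C_X_sub_map_C_ne_zero [Nontrivial O] (g : MvPolynomial ι O) :
    (C Polynomial.X - map Polynomial.C g : MvPolynomial ι (Polynomial O)) ≠ 0 := by
  intro h
  have := congrArg (coeff 0) h
  rw [coeff_sub, coeff_zero_C, coeff_map, coeff_zero, sub_eq_zero] at this
  exact Polynomial.X_ne_C _ this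

theorem map_substPoly (𝔬 : Ideal O) {s : ℕ} (f : Fin (s + 1) → MvPolynomial ι O) :
    (((𝔬.map Polynomial.C ⊔ Ideal.span {Polynomial.X}).map C ⊔
      Ideal.span (Set.range fun i : Fin s => map Polynomial.C (f i.castSucc))).map
        (substPoly (f (Fin.last s)))) =
      𝔬.map C ⊔ Ideal.span (Set.range f) := by
  set g := f (Fin.last s)
  have h1 : ((substPoly g).comp (C : Polynomial O →+* MvPolynomial ι (Polynomial O))).comp
      (Polynomial.C : O →+* Polynomial O) = C :=
    RingHom.ext fun c => by simp [substPoly_C_C]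
  rw [Ideal.map_sup, Ideal.map_sup, Ideal.map_sup, Ideal.map_map, Ideal.map_map, h1,
    Ideal.map_span, Ideal.map_span, Ideal.map_span, sup_assoc, Set.image_singleton,
    Set.image_singleton, substPoly_C_X, ← Set.range_comp, ← Ideal.span_union]
  congr 2
  ext p
  simp only [Set.mem_union, Set.mem_singleton_iff, Set.mem_range, Function.comp_apply,
    substPoly_map_C]
  constructor
  · rintro (rfl | ⟨i, rfl⟩)
    exacts [⟨_, rfl⟩, ⟨_, rfl⟩]
  · rintro ⟨i, rfl⟩
    induction i using Fin.lastCases with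
    | last => exact Or.inl rfl
    | cast i => exact Or.inr ⟨i, rfl⟩

end Step

theorem uniformlyExact_of_add_le {ι : Type} [Fintype ι] [DecidableEq ι] {O : Type u} [CommRing O]
    [IsDomain O] [IsNoetherianRing O] (𝔬 : Ideal O) (s : ℕ) (f : Fin s → MvPolynomial ι O) (m : ℕ)
    (h : m + s + 2 ≤ Fintype.card ι) :
    UniformlyExact (toLaurent ι O) X (𝔬.map C ⊔ Ideal.span (Set.range f)) m := by
  induction s generalizing O m with
  | zero =>
    rw [Set.range_eq_empty f, Ideal.span_empty, sup_bot_eq]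
    exact uniformlyExact_map_C 𝔬 m (by omega)
  | succ s ih =>
    refine uniformlyExact_of_ker_eq_span (substPoly (f (Fin.last s)))
      (substLaurent (f (Fin.last s)))
      (substLaurent_toLaurent _) (substPoly_X _) isUnit_toLaurent_X
      (fun p => ⟨_, substPoly_map_C _ p⟩) toLaurent_injective (ker_substPoly _) (fun y hy => ?_)
      (map_substPoly 𝔬 f) (ih _ _ m (by omega)) (ih _ _ (m + 1) (by omega))
    exact (mul_eq_zero.mp hy).resolve_left
      (fun h0 => C_X_sub_map_C_ne_zero _ (toLaurent_injective (h0.trans (map_zero _).symm)))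

theorem cobd_pair {ι A : Type*} [AddCommGroup A] (α : List ι → A) (z w : ι) :
    cobd α [z, w] = α [w] - α [z] := by
  simp [cobd]

theorem cobd_triple {ι A : Type*} [AddCommGroup A] (α : List ι → A) (z w y : ι) :
    cobd α [z, w, y] = α [w, y] - α [z, y] + α [z, w] := by
  simp [cobd]
  abel

theorem cobd_quadruple {ι A : Type*} [AddCommGroup A] (α : List ι → A) (i j k l : ι) :
    cobd α [i, j, k, l] = α [j, k, l] - α [i, k, l] + α [i, j, l] - α [i, j, k] := by
  simp [cobd]
  abel

theorem exists_inverse_mod_pow {ι R Λ : Type*} [CommRing R] [CommRing Λ]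
    {φ : R →+* Λ} {x : ι → R} {J : Ideal R} {S : Finset ι} {a b : Λ}
    (ha : a ∈ loc φ x S ⊤) (hb : b ∈ loc φ x S ⊤) (hab : a * b - 1 ∈ loc φ x S J) (K : ℕ) :
    ∃ b' ∈ loc φ x S ⊤, a * b' - 1 ∈ loc φ x S (J ^ K) := by
  induction K with
  | zero =>
    rw [pow_zero, Ideal.one_eq_top]
    exact ⟨b, hb, sub_mem (mul_mem_loc_left ha hb) (one_mem_loc S)⟩
  | succ K ih =>
    obtain ⟨b', hb', h⟩ := ih
    refine ⟨b' - (a * b' - 1) * b,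
      sub_mem hb' (mul_mem_loc_left (loc_mono_right le_top h) hb), ?_⟩
    have : a * (b' - (a * b' - 1) * b) - 1 = - ((a * b' - 1) * (a * b - 1)) := by ring
    rw [this, pow_succ]
    exact neg_mem (mul_mem_loc h hab)

section Cocycle

variable {ι R Λ : Type*} [DecidableEq ι] [CommRing R] [CommRing Λ]

/-- A family satisfying the multiplicative cocycle condition modulo `J ^ M` and congruent to `g₀`
modulo `J`. -/
structure IsApproxCocycle (φ : R →+* Λ) (x : ι → R) (J : Ideal R) (g₀ : ι → ι → Λ) (M : ℕ)
    (g : ι → ι → Λ) : Prop where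
  mem : ∀ z w, g z w ∈ loc φ x [z, w].toFinset ⊤
  sub_base_mem : ∀ z w, g z w - g₀ z w ∈ loc φ x [z, w].toFinset J
  mul_sub_mem_pow : ∀ z w y, g z w * g w y - g z y ∈ loc φ x [z, w, y].toFinset (J ^ M)

variable {φ : R →+* Λ} {x : ι → R} {J : Ideal R} {g₀ : ι → ι → Λ}

theorem IsApproxCocycle.mono {M M' : ℕ} {g : ι → ι → Λ} (h : IsApproxCocycle φ x J g₀ M g)
    (hM : M' ≤ M) : IsApproxCocycle φ x J g₀ M' g :=
  ⟨h.mem, h.sub_base_mem,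
    fun z w y => loc_mono_right (Ideal.pow_le_pow_right hM) (h.mul_sub_mem_pow z w y)⟩

theorem IsApproxCocycle.exists_inverse {M : ℕ} {g : ι → ι → Λ}
    (h : IsApproxCocycle φ x J g₀ M g) (hg₀ : ∀ z w, g₀ z w ∈ loc φ x [z, w].toFinset ⊤)
    (hg₀' : ∀ z w, g₀ z w * g₀ w z - 1 ∈ loc φ x [z, w].toFinset J) (K : ℕ) :
    ∃ g' : ι → ι → Λ, (∀ z w, g' z w ∈ loc φ x [z, w].toFinset ⊤) ∧
      ∀ z w, g z w * g' z w - 1 ∈ loc φ x [z, w].toFinset (J ^ K) := by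
  have key : ∀ z w, ∃ b ∈ loc φ x [z, w].toFinset ⊤,
      g z w * b - 1 ∈ loc φ x [z, w].toFinset (J ^ K) := by
    intro z w
    have h0 : g₀ w z ∈ loc φ x [z, w].toFinset ⊤ :=
      loc_mono_left ⊤ (by intro i; simp; tauto) (hg₀ w z)
    refine exists_inverse_mod_pow (h.mem z w) h0 ?_ K
    have : g z w * g₀ w z - 1 = (g z w - g₀ z w) * g₀ w z + (g₀ z w * g₀ w z - 1) := by ring
    rw [this]
    exact add_mem (mul_mem_loc_left (h.sub_base_mem z w) h0) (hg₀' z w)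
  choose g' hg' using key
  exact ⟨g', fun z w => (hg' z w).1, fun z w => (hg' z w).2⟩

theorem IsApproxCocycle.improve {c M : ℕ}
    (hc : ∀ (M k : ℕ) (α : List ι → Λ),
      (∀ I : List ι, I.length = 2 + 1 → α I ∈ loc φ x I.toFinset (J ^ M)) →
      (∀ I : List ι, I.length = 2 + 2 → cobd α I ∈ loc φ x I.toFinset (J ^ k)) →
      ∃ ε : List ι → Λ,
        (∀ I : List ι, I.length = 2 → ε I ∈ loc φ x I.toFinset (J ^ (M - c))) ∧
        (∀ I : List ι, I.length = 2 + 1 → α I - cobd ε I ∈ loc φ x I.toFinset (J ^ (k - c))))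
    (hg₀ : ∀ z w, g₀ z w ∈ loc φ x [z, w].toFinset ⊤)
    (hg₀' : ∀ z w, g₀ z w * g₀ w z - 1 ∈ loc φ x [z, w].toFinset J) (hM : c + 1 ≤ M) {g : ι → ι → Λ}
    (h : IsApproxCocycle φ x J g₀ M g) :
    ∃ g₁ : ι → ι → Λ, IsApproxCocycle φ x J g₀ (2 * M - 2 * c) g₁ := by
  obtain ⟨g', hg', hgg'⟩ := h.exists_inverse hg₀ hg₀' (2 * M)
  have mono : ∀ {S T : Finset ι} {a b : ℕ} {z : Λ}, S ⊆ T → b ≤ a → z ∈ loc φ x S (J ^ a) →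
      z ∈ loc φ x T (J ^ b) := fun hS hab hz =>
    loc_mono_left _ hS (loc_mono_right (Ideal.pow_le_pow_right hab) hz)
  have top : ∀ {S T : Finset ι} {𝔞 : Ideal R} {z : Λ}, S ⊆ T → z ∈ loc φ x S 𝔞 →
      z ∈ loc φ x T ⊤ := fun hS hz => loc_mono_left _ hS (loc_mono_right le_top hz)
  have mulpow : ∀ {S : Finset ι} {a b k : ℕ} {z w : Λ}, k ≤ a + b → z ∈ loc φ x S (J ^ a) →
      w ∈ loc φ x S (J ^ b) → z * w ∈ loc φ x S (J ^ k) := by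
    intro S a b k z w hk hz hw
    refine loc_mono_right (Ideal.pow_le_pow_right hk) ?_
    rw [pow_add]
    exact mul_mem_loc hz hw
  let δ : List ι → Λ
    | [z, w, y] => g z w * g w y * g' z y - 1
    | _ => 0
  have hδ3 : ∀ z w y, δ [z, w, y] = g z w * g w y * g' z y - 1 := fun _ _ _ => rfl
  have hδ : ∀ z w y, δ [z, w, y] ∈ loc φ x [z, w, y].toFinset (J ^ M) := by
    intro z w y
    have : δ [z, w, y] = (g z w * g w y - g z y) * g' z y + (g z y * g' z y - 1) := by
      rw [hδ3]; ring
    rw [this]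
    refine add_mem (mul_mem_loc_left (h.mul_sub_mem_pow z w y) (top ?_ (hg' z y)))
      (mono ?_ (by omega) (hgg' z y))
    all_goals intro i; simp; tauto
  obtain ⟨ε, hε, hε'⟩ := hc M (2 * M) δ
    (fun I hI => by
      obtain ⟨z, w, y, rfl⟩ := List.length_eq_three.mp hI
      exact hδ z w y)
    (fun I hI => by
      obtain ⟨i, I, rfl⟩ := List.exists_cons_of_length_eq_add_one hI
      obtain ⟨j, k, l, rfl⟩ := List.length_eq_three.mp (by simpa using hI)
      have hA : g j k * g k l * g i j * g' i l ∈ loc φ x [i, j, k, l].toFinset ⊤ := by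
        refine mul_mem_loc_left (mul_mem_loc_left (mul_mem_loc_left ?_ ?_) ?_) ?_
        · exact top (by intro i; simp; tauto) (h.mem j k)
        · exact top (by intro a; simp; tauto) (h.mem k l)
        · exact top (by intro i; simp; tauto) (h.mem i j)
        · exact top (by intro i; simp; tauto) (hg' i l)
      have : cobd δ [i, j, k, l] =
          (g j k * g k l * g i j * g' i l) * (g j l * g' j l - 1)
          - (g j k * g k l * g i j * g' i l) * (g i k * g' i k - 1)
          - δ [j, k, l] * δ [i, j, l] + δ [i, k, l] * δ [i, j, k] := by
        rw [cobd_quadruple]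
        simp only [hδ3]
        ring
      rw [this]
      refine add_mem (sub_mem (sub_mem (mul_mem_loc_right hA (mono ?_ le_rfl (hgg' j l)))
        (mul_mem_loc_right hA (mono ?_ le_rfl (hgg' i k))))
        (mulpow (by omega) (mono ?_ le_rfl (hδ j k l)) (mono ?_ le_rfl (hδ i j l))))
        (mulpow (by omega) (mono ?_ le_rfl (hδ i k l)) (mono ?_ le_rfl (hδ i j k)))
      all_goals intro a; simp; try tauto)
  have hε2 : ∀ z w, ε [z, w] ∈ loc φ x [z, w].toFinset (J ^ (M - c)) := fun z w => hε [z, w] rfl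
  have hε3 : ∀ z w y, δ [z, w, y] - cobd ε [z, w, y] ∈
      loc φ x [z, w, y].toFinset (J ^ (2 * M - c)) := fun z w y => hε' [z, w, y] rfl
  refine ⟨fun z w => g z w * (1 - ε [z, w]), fun z w => ?_, fun z w => ?_, fun z w y => ?_⟩
  · exact mul_mem_loc_left (h.mem z w) (sub_mem (one_mem_loc _) (top subset_rfl (hε2 z w)))
  · have : g z w * (1 - ε [z, w]) - g₀ z w = (g z w - g₀ z w) - g z w * ε [z, w] := by ring
    rw [this]
    refine sub_mem (h.sub_base_mem z w) (mul_mem_loc_right (h.mem z w) ?_)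
    have := mono subset_rfl (by omega : 1 ≤ M - c) (hε2 z w)
    rwa [pow_one] at this
  · have h1 : [z, w].toFinset ⊆ [z, w, y].toFinset := by intro a; simp; tauto
    have h2 : [w, y].toFinset ⊆ [z, w, y].toFinset := by intro a; simp; tauto
    have h3 : [z, y].toFinset ⊆ [z, w, y].toFinset := by intro a; simp; tauto
    have : g z w * (1 - ε [z, w]) * (g w y * (1 - ε [w, y])) - g z y * (1 - ε [z, y]) =
        g z y * (δ [z, w, y] - cobd ε [z, w, y])
        + g z y * (ε [z, w] * ε [w, y])
        - g z y * ((1 - ε [w, y]) * (δ [z, w, y] * ε [z, w]))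
        - g z y * (δ [z, w, y] * ε [w, y])
        - (g z w * g w y * ((1 - ε [z, w]) * (1 - ε [w, y]))) * (g z y * g' z y - 1) := by
      rw [cobd_triple, hδ3]
      ring
    rw [this]
    have hg := top h3 (h.mem z y)
    have e1 := mono h1 le_rfl (hε2 z w)
    have e2 := mono h2 le_rfl (hε2 w y)
    have o1 := sub_mem (one_mem_loc _) (top h1 (hε2 z w))
    have o2 := sub_mem (one_mem_loc _) (top h2 (hε2 w y))
    refine sub_mem (sub_mem (sub_mem (add_mem ?_ ?_) ?_) ?_) ?_
    · exact mono subset_rfl (by omega) (mul_mem_loc_right hg (hε3 z w y))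
    · exact mul_mem_loc_right hg (mulpow (by omega) e1 e2)
    · exact mul_mem_loc_right hg (mul_mem_loc_right o2 (mulpow (by omega) (hδ z w y) e1))
    · exact mul_mem_loc_right hg (mulpow (by omega) (hδ z w y) e2)
    · refine mul_mem_loc_right (mul_mem_loc_left (mul_mem_loc_left (top h1 (h.mem z w))
        (top h2 (h.mem w y))) (mul_mem_loc_left o1 o2)) (mono h3 (by omega) (hgg' z y))

theorem exists_isApproxCocycle (hJ : UniformlyExact φ x J 2) :
    ∃ M₀ : ℕ, ∀ g₀ : ι → ι → Λ, (∀ z w, g₀ z w * g₀ w z - 1 ∈ loc φ x [z, w].toFinset J) →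
      IsApproxCocycle φ x J g₀ M₀ g₀ → ∀ M, ∃ g, IsApproxCocycle φ x J g₀ M g := by
  obtain ⟨c, hc⟩ := hJ
  refine ⟨2 * c + 1, fun g₀ hg₀' h₀ M => ?_⟩
  suffices H : ∀ M, ∃ g, IsApproxCocycle φ x J g₀ (2 * c + 1 + M) g by
    obtain ⟨g, hg⟩ := H M
    exact ⟨g, hg.mono (by omega)⟩
  intro M
  induction M with
  | zero => exact ⟨g₀, h₀⟩
  | succ M ih =>
    obtain ⟨g, hg⟩ := ih
    obtain ⟨g₁, hg₁⟩ := hg.improve hc h₀.mem hg₀' (by omega)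
    exact ⟨g₁, hg₁.mono (by omega)⟩

theorem exists_logDeriv_primitive (hJ : UniformlyExact φ x J 1) :
    ∃ c : ℕ, ∀ (M : ℕ) (g g' : ι → ι → Λ) (D : Λ →+ Λ),
      (∀ a b, D (a * b) = b * D a + a * D b) →
      (∀ (S : Finset ι) (k : ℕ) (z : Λ), z ∈ loc φ x S (J ^ k) → D z ∈ loc φ x S (J ^ (k - 1))) →
      IsApproxCocycle φ x J g₀ M g →
      (∀ z w, g' z w ∈ loc φ x [z, w].toFinset ⊤) →
      (∀ z w, g z w * g' z w - 1 ∈ loc φ x [z, w].toFinset (J ^ M)) →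
      ∃ ω : ι → Λ, (∀ z, ω z ∈ loc φ x {z} ⊤) ∧
        ∀ z w, g' z w * D (g z w) - (ω w - ω z) ∈ loc φ x [z, w].toFinset (J ^ (M - 1 - c)) := by
  obtain ⟨c, hc⟩ := hJ
  refine ⟨c, fun M g g' D hD hDloc h hg' hgg' => ?_⟩
  have top : ∀ {S T : Finset ι} {𝔞 : Ideal R} {z : Λ}, S ⊆ T → z ∈ loc φ x S 𝔞 →
      z ∈ loc φ x T ⊤ := fun hS hz => loc_mono_left _ hS (loc_mono_right le_top hz)
  have mono : ∀ {S T : Finset ι} {a b : ℕ} {z : Λ}, S ⊆ T → b ≤ a → z ∈ loc φ x S (J ^ a) →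
      z ∈ loc φ x T (J ^ b) := fun hS hab hz =>
    loc_mono_left _ hS (loc_mono_right (Ideal.pow_le_pow_right hab) hz)
  have hDg : ∀ z w, D (g z w) ∈ loc φ x [z, w].toFinset ⊤ := fun z w =>
    top subset_rfl (hDloc _ 0 _ (by simpa using h.mem z w))
  let w : List ι → Λ
    | [i, j] => g' i j * D (g i j)
    | _ => 0
  have hw : ∀ i j, w [i, j] = g' i j * D (g i j) := fun _ _ => rfl
  obtain ⟨ε, hε, hε'⟩ := hc 0 (M - 1) w
    (fun I hI => by
      obtain ⟨i, j, rfl⟩ := List.length_eq_two.mp hI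
      simpa using mul_mem_loc_left (hg' i j) (hDg i j))
    (fun I hI => by
      obtain ⟨i, j, k, rfl⟩ := List.length_eq_three.mp hI
      have h1 : [i, j].toFinset ⊆ [i, j, k].toFinset := by intro a; simp; tauto
      have h2 : [j, k].toFinset ⊆ [i, j, k].toFinset := by intro a; simp; tauto
      have h3 : [i, k].toFinset ⊆ [i, j, k].toFinset := by intro a; simp; tauto
      have : cobd w [i, j, k] =
          g' i j * g' j k * D (g i j * g j k - g i k)
          - g' i j * D (g i j) * (g j k * g' j k - 1)
          - g' j k * D (g j k) * (g i j * g' i j - 1)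
          + D (g i k) * (
            - (g' i k * g' i j * g' j k) * (g i j * g j k - g i k)
            - g' i j * g' j k * (g i k * g' i k - 1)
            + g' i k * (g i j * g' i j) * (g j k * g' j k - 1)
            + g' i k * (g i j * g' i j - 1)) := by
        rw [cobd_triple, map_sub, hD]
        simp only [hw]
        ring
      rw [this]
      have a1 := top h1 (hg' i j)
      have a2 := top h2 (hg' j k)
      have a3 := top h3 (hg' i k)
      have b1 := top h1 (hDg i j)
      have b2 := top h2 (hDg j k)
      have b3 := top h3 (hDg i k)
      have c1 := mono h1 (by omega : M - 1 ≤ M) (hgg' i j)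
      have c2 := mono h2 (by omega : M - 1 ≤ M) (hgg' j k)
      have c3 := mono h3 (by omega : M - 1 ≤ M) (hgg' i k)
      have d := h.mul_sub_mem_pow i j k
      have e1 := top h1 (h.mem i j)
      refine add_mem (sub_mem (sub_mem ?_ ?_) ?_) (mul_mem_loc_right b3
        (add_mem (add_mem (sub_mem ?_ ?_) ?_) ?_))
      · exact mul_mem_loc_right (mul_mem_loc_left a1 a2) (hDloc _ _ _ d)
      · exact mul_mem_loc_right (mul_mem_loc_left a1 b1) c2
      · exact mul_mem_loc_right (mul_mem_loc_left a2 b2) c1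
      · exact mul_mem_loc_right (neg_mem (mul_mem_loc_left (mul_mem_loc_left a3 a1) a2))
          (mono subset_rfl (by omega) d)
      · exact mul_mem_loc_right (mul_mem_loc_left a1 a2) c3
      · exact mul_mem_loc_right (mul_mem_loc_left a3 (mul_mem_loc_left e1 a1)) c2
      · exact mul_mem_loc_right a3 c1)
  refine ⟨fun z => ε [z], fun z => ?_, fun z w => ?_⟩
  · simpa using hε [z] rfl
  · have := hε' [z, w] rfl
    rwa [cobd_pair] at this

end Cocycle

section PrimePower

variable {R : Type*} [CommRing R] {J : Ideal R} {p : ℕ}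

theorem pow_prime_sub_pow_mem (hp : p.Prime) (hpJ : (p : R) ∈ J) {a b : R} {j : ℕ}
    (h : a - b ∈ J ^ (j + 1)) : a ^ p - b ^ p ∈ J ^ (j + 2) := by
  obtain ⟨r, hr⟩ := exists_add_pow_prime_eq hp (a - b) b
  rw [sub_add_cancel] at hr
  have : a ^ p - b ^ p = (a - b) ^ p + p * (a - b) * (b * r) := by rw [hr]; ring
  rw [this]
  refine add_mem ?_ (Ideal.mul_mem_right _ _ ?_)
  · have h1 := Ideal.pow_mem_pow h p
    rw [← pow_mul] at h1
    refine Ideal.pow_le_pow_right ?_ h1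
    nlinarith [hp.two_le]
  · rw [pow_succ' J (j + 1)]
    exact Ideal.mul_mem_mul hpJ h

theorem pow_prime_pow_sub_mem (hp : p.Prime) (hpJ : (p : R) ∈ J) {a b : R}
    (h : a - b ∈ J) (m : ℕ) : a ^ p ^ m - b ^ p ^ m ∈ J ^ (m + 1) := by
  induction m with
  | zero => simpa using h
  | succ m ih =>
    rw [pow_succ p, pow_mul, pow_mul]
    exact pow_prime_sub_pow_mem hp hpJ ih

theorem exists_pow_prime_pow_sub_mem [IsNoetherianRing R] (hp : p.Prime) (hpJ : (p : R) ∈ J)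
    (M : ℕ) : ∃ e : ℕ, ∀ a b : R, a - b ∈ J.radical → a ^ p ^ e - b ^ p ^ e ∈ J ^ M := by
  obtain ⟨r, hr⟩ := J.exists_radical_pow_le_of_fg (IsNoetherian.noetherian _)
  refine ⟨r + M, fun a b hab => ?_⟩
  have h1 : (a - b) ^ p ^ r ∈ J :=
    hr (Ideal.pow_le_pow_right (Nat.lt_pow_self hp.one_lt).le (Ideal.pow_mem_pow hab _))
  have h2 : a ^ p ^ r - b ^ p ^ r ∈ J := by
    obtain ⟨s, hs⟩ := exists_add_pow_prime_pow_eq hp (a - b) b r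
    rw [sub_add_cancel] at hs
    rw [hs, add_right_comm, add_sub_cancel_right]
    rw [mul_assoc, mul_assoc]
    exact add_mem h1 (J.mul_mem_right _ hpJ)
  have h3 := pow_prime_pow_sub_mem hp hpJ h2 M
  rw [pow_add, pow_mul, pow_mul]
  exact Ideal.pow_le_pow_right (Nat.le_succ M) h3

end PrimePower

section EulerOperator

variable {O A B : Type*} [CommRing O] [AddCommGroup A] [AddCommGroup B]

/-- The derivation of a group algebra that multiplies the term of exponent `a` by `χ a`. -/
noncomputable def eulerOp (O : Type*) [CommRing O] (χ : A →+ ℤ) :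
    AddMonoidAlgebra O A →+ AddMonoidAlgebra O A where
  toFun z := .ofCoeff <| Finsupp.onFinset z.coeff.support (fun a => χ a • z.coeff a)
    (fun a ha => by
      rw [Finsupp.mem_support_iff]
      intro h
      simp [h] at ha)
  map_zero' := by ext; simp
  map_add' z w := by ext; simp

theorem coeff_eulerOp (χ : A →+ ℤ) (z : AddMonoidAlgebra O A) (a : A) :
    (eulerOp O χ z).coeff a = χ a • z.coeff a := rfl

theorem eulerOp_single (χ : A →+ ℤ) (a : A) (c : O) :
    eulerOp O χ (AddMonoidAlgebra.single a c) = χ a • AddMonoidAlgebra.single a c := by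
  classical
  ext b
  by_cases h : a = b
  · subst h; simp [coeff_eulerOp]
  · simp [coeff_eulerOp, h]

theorem eulerOp_mul (χ : A →+ ℤ) (z w : AddMonoidAlgebra O A) :
    eulerOp O χ (z * w) = w * eulerOp O χ z + z * eulerOp O χ w := by
  induction z using AddMonoidAlgebra.induction_linear with
  | zero => simp
  | add z₁ z₂ h₁ h₂ => rw [add_mul, map_add, h₁, h₂, map_add]; ring
  | single a c =>
    induction w using AddMonoidAlgebra.induction_linear with
    | zero => simp
    | add w₁ w₂ h₁ h₂ => rw [mul_add, map_add, h₁, h₂, map_add]; ring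
    | single b d =>
      rw [AddMonoidAlgebra.single_mul_single, eulerOp_single, eulerOp_single, eulerOp_single,
        mul_smul_comm, mul_smul_comm, mul_comm (AddMonoidAlgebra.single b d),
        AddMonoidAlgebra.single_mul_single, map_add, add_smul]

theorem eulerOp_add (χ χ' : A →+ ℤ) (z : AddMonoidAlgebra O A) :
    eulerOp O (χ + χ') z = eulerOp O χ z + eulerOp O χ' z := by
  ext a
  simp [coeff_eulerOp, add_mul]

theorem eulerOp_pow_succ (χ : A →+ ℤ) (z : AddMonoidAlgebra O A) (n : ℕ) :
    eulerOp O χ (z ^ (n + 1)) = (n + 1 : ℕ) • (z ^ n * eulerOp O χ z) := by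
  induction n with
  | zero => simp
  | succ n ih =>
    rw [pow_succ, eulerOp_mul, ih, nsmul_eq_mul, nsmul_eq_mul]
    push_cast
    ring

theorem singleZeroRingHom_eq_single (c : O) :
    AddMonoidAlgebra.singleZeroRingHom (M := A) c = AddMonoidAlgebra.single 0 c := rfl

theorem mem_map_singleZero_iff (𝔟 : Ideal O) (z : AddMonoidAlgebra O A) :
    z ∈ 𝔟.map (AddMonoidAlgebra.singleZeroRingHom (R := O) (M := A)) ↔ ∀ a, z.coeff a ∈ 𝔟 := by
  constructor
  · have hle : 𝔟.map (AddMonoidAlgebra.singleZeroRingHom (R := O) (M := A)) ≤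
        RingHom.ker (AddMonoidAlgebra.mapRingHom A (Ideal.Quotient.mk 𝔟)) := by
      rw [Ideal.map_le_iff_le_comap]
      intro c hc
      rw [Ideal.mem_comap, RingHom.mem_ker, singleZeroRingHom_eq_single,
        AddMonoidAlgebra.mapRingHom_single, Ideal.Quotient.eq_zero_iff_mem.mpr hc,
        AddMonoidAlgebra.single_zero]
    intro hz a
    have h := congrArg (fun w => w.coeff a) ((RingHom.mem_ker).mp (hle hz))
    simp only [AddMonoidAlgebra.coeff_mapRingHom, AddMonoidAlgebra.coeff_zero,
      Finsupp.coe_zero, Pi.zero_apply] at h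
    exact Ideal.Quotient.eq_zero_iff_mem.mp h
  · intro h
    rw [← AddMonoidAlgebra.sum_single_coeff z]
    refine sum_mem fun a _ => ?_
    have : AddMonoidAlgebra.single a (z.coeff a) =
        AddMonoidAlgebra.singleZeroRingHom (z.coeff a) * AddMonoidAlgebra.single a 1 := by
      rw [singleZeroRingHom_eq_single, AddMonoidAlgebra.single_mul_single, zero_add,
        mul_one]
    rw [this]
    exact Ideal.mul_mem_right _ _ (Ideal.mem_map_of_mem _ (h a))

theorem coeff_zero_mul_eulerOp_mem [IsDomain O] [CharZero O] {𝔬 : Ideal O} {p : ℕ} (hp : p.Prime)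
    (hp𝔬 : (p : O) ∈ 𝔬) (χ : A →+ ℤ) {h w : AddMonoidAlgebra O A} {K : ℕ}
    (hh : h - 1 ∈ 𝔬.map (AddMonoidAlgebra.singleZeroRingHom (R := O) (M := A)))
    (hw : w * h - 1 ∈ (𝔬 ^ K).map (AddMonoidAlgebra.singleZeroRingHom (R := O) (M := A))) :
    (w * eulerOp O χ h).coeff 0 ∈ 𝔬 ^ K := by
  set ct := AddMonoidAlgebra.singleZeroRingHom (R := O) (M := A)
  have hpct : (p : AddMonoidAlgebra O A) ∈ 𝔬.map ct := by
    have := Ideal.mem_map_of_mem ct hp𝔬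
    rwa [map_natCast] at this
  obtain ⟨N, hN⟩ : ∃ N, p ^ K = N + 1 :=
    ⟨p ^ K - 1, by have := hp.pos; have := pow_pos this K; omega⟩
  have h1 : h ^ (N + 1) - 1 ∈ (𝔬 ^ K).map ct := by
    have := pow_prime_pow_sub_mem hp hpct hh K
    rw [one_pow, hN] at this
    rw [Ideal.map_pow]
    exact Ideal.pow_le_pow_right (Nat.le_succ K) this
  have h2 : w - h ^ N ∈ (𝔬 ^ K).map ct := by
    have : w - h ^ N = (w * h - 1) * h ^ N - w * (h ^ (N + 1) - 1) := by ring
    rw [this]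
    exact sub_mem (Ideal.mul_mem_right _ _ hw) (Ideal.mul_mem_left _ _ h1)
  have h3 : (h ^ N * eulerOp O χ h).coeff 0 = 0 := by
    have := congrArg (fun z => z.coeff 0) (eulerOp_pow_succ (O := O) χ h N)
    simp only [coeff_eulerOp, map_zero, zero_smul, AddMonoidAlgebra.coeff_smul,
      Finsupp.smul_apply] at this
    exact (smul_eq_zero.mp this.symm).resolve_left (Nat.succ_ne_zero N)
  have h4 : (w * eulerOp O χ h).coeff 0 = ((w - h ^ N) * eulerOp O χ h).coeff 0 := by
    rw [sub_mul, AddMonoidAlgebra.coeff_sub, Finsupp.sub_apply, h3, sub_zero]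
  rw [h4]
  exact (mem_map_singleZero_iff _ _).mp (Ideal.mul_mem_right _ _ h2) 0

/-- Discard the terms whose exponent does not satisfy `Q` and push exponents forward along `ψ`. -/
noncomputable def filterMap (O : Type*) [CommRing O] (Q : A → Prop) [DecidablePred Q] (ψ : A →+ B) :
    AddMonoidAlgebra O A →+ AddMonoidAlgebra O B where
  toFun z := AddMonoidAlgebra.mapDomain ψ (.ofCoeff (z.coeff.filter Q))
  map_zero' := by
    rw [AddMonoidAlgebra.coeff_zero, Finsupp.filter_zero]
    exact AddMonoidAlgebra.mapDomain_zero _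
  map_add' z w := by
    rw [AddMonoidAlgebra.coeff_add, Finsupp.filter_add, AddMonoidAlgebra.ofCoeff_add,
      AddMonoidAlgebra.mapDomain_add]

theorem filterMap_single_pos {Q : A → Prop} [DecidablePred Q] (ψ : A →+ B) {a : A} (h : Q a)
    (c : O) :
    filterMap O Q ψ (AddMonoidAlgebra.single a c) = AddMonoidAlgebra.single (ψ a) c := by
  have : (Finsupp.single a c).filter Q = Finsupp.single a c :=
    Finsupp.filter_single_of_pos _ h
  change AddMonoidAlgebra.mapDomain ψ (.ofCoeff ((Finsupp.single a c).filter Q)) = _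
  rw [this]
  exact AddMonoidAlgebra.mapDomain_single

theorem filterMap_single_neg {Q : A → Prop} [DecidablePred Q] (ψ : A →+ B) {a : A} (h : ¬ Q a)
    (c : O) :
    filterMap O Q ψ (AddMonoidAlgebra.single a c) = 0 := by
  have : (Finsupp.single a c).filter Q = 0 :=
    Finsupp.filter_single_of_neg _ h
  change AddMonoidAlgebra.mapDomain ψ (.ofCoeff ((Finsupp.single a c).filter Q)) = _
  rw [this]
  exact AddMonoidAlgebra.mapDomain_zero _

theorem filterMap_mul {N Q : A → Prop} [DecidablePred Q] (ψ : A →+ B)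
    (hQ : ∀ a b, N a → N b → (Q (a + b) ↔ Q a ∧ Q b)) {z w : AddMonoidAlgebra O A}
    (hz : ∀ a, z.coeff a ≠ 0 → N a) (hw : ∀ a, w.coeff a ≠ 0 → N a) :
    filterMap O Q ψ (z * w) = filterMap O Q ψ z * filterMap O Q ψ w := by
  conv_lhs => rw [← AddMonoidAlgebra.sum_single_coeff z, ← AddMonoidAlgebra.sum_single_coeff w]
  conv_rhs => rw [← AddMonoidAlgebra.sum_single_coeff z, ← AddMonoidAlgebra.sum_single_coeff w]
  rw [Finset.sum_mul_sum, map_sum, map_sum, map_sum, Finset.sum_mul_sum]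
  refine Finset.sum_congr rfl fun a ha => ?_
  rw [map_sum]
  refine Finset.sum_congr rfl fun b hb => ?_
  have hab := hQ a b (hz a (by simpa using ha)) (hw b (by simpa using hb))
  rw [AddMonoidAlgebra.single_mul_single]
  by_cases h₁ : Q a
  · by_cases h₂ : Q b
    · rw [filterMap_single_pos _ (hab.mpr ⟨h₁, h₂⟩), filterMap_single_pos _ h₁,
        filterMap_single_pos _ h₂, AddMonoidAlgebra.single_mul_single, map_add]
    · rw [filterMap_single_neg _ (fun h => h₂ (hab.mp h).2), filterMap_single_neg _ h₂, mul_zero]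
  · rw [filterMap_single_neg _ (fun h => h₁ (hab.mp h).1), filterMap_single_neg _ h₁, zero_mul]

theorem filterMap_eulerOp (Q : A → Prop) [DecidablePred Q] (ψ : A →+ B) (χ : B →+ ℤ)
    (z : AddMonoidAlgebra O A) :
    filterMap O Q ψ (eulerOp O (χ.comp ψ) z) = eulerOp O χ (filterMap O Q ψ z) := by
  induction z using AddMonoidAlgebra.induction_linear with
  | zero => simp
  | add z w hz hw => simp only [map_add, hz, hw]
  | single a c =>
    rw [eulerOp_single, map_zsmul]
    by_cases h : Q a
    · rw [filterMap_single_pos _ h, eulerOp_single, AddMonoidHom.comp_apply]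
    · rw [filterMap_single_neg _ h, smul_zero, map_zero]

theorem coeff_zero_filterMap {Q : A → Prop} [DecidablePred Q] {ψ : A →+ B}
    {z : AddMonoidAlgebra O A}
    (h : ∀ a, Q a → ψ a = 0 → z.coeff a = 0) : (filterMap O Q ψ z).coeff 0 = 0 := by
  classical
  rw [← AddMonoidAlgebra.sum_single_coeff z, map_sum, AddMonoidAlgebra.coeff_sum,
    Finsupp.finsetSum_apply]
  refine Finset.sum_eq_zero fun a ha => ?_
  by_cases hQ : Q a
  · rw [filterMap_single_pos _ hQ, AddMonoidAlgebra.coeff_single, Finsupp.single_apply]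
    split_ifs with h0
    · exact h a hQ h0
    · rfl
  · rw [filterMap_single_neg _ hQ]
    simp

end EulerOperator

theorem pderiv_mem_pow {ι O : Type*} [CommRing O] (J : Ideal (MvPolynomial ι O)) (i : ι) (k : ℕ)
    {f : MvPolynomial ι O}
    (hf : f ∈ J ^ k) : pderiv i f ∈ J ^ (k - 1) := by
  induction k generalizing f with
  | zero => simp
  | succ k ih =>
    rw [pow_succ] at hf
    refine Submodule.mul_induction_on hf (fun a ha b hb => ?_) (fun a b ha hb => ?_)
    · rw [pderiv_mul, Nat.add_sub_cancel]
      refine add_mem ?_ (Ideal.mul_mem_right _ _ ha)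
      rcases k with _ | k
      · simp
      · rw [pow_succ]
        exact Ideal.mul_mem_mul (ih ha) hb
    · rw [map_add]
      exact add_mem ha hb


section PartialDerivative

variable {ι O : Type*} [DecidableEq ι] [CommRing O]

/-- The inverse of a variable in the ring of Laurent polynomials. -/
noncomputable def invVar (O : Type*) [CommRing O] (i : ι) : AddMonoidAlgebra O (ι → ℤ) :=
  AddMonoidAlgebra.single (-Pi.single i 1) 1

theorem toLaurent_X_mul_invVar (i : ι) : toLaurent ι O (X i) * invVar O i = 1 := by
  rw [toLaurent_X, invVar, AddMonoidAlgebra.single_mul_single, add_neg_cancel, one_mul]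
  rfl

/-- The partial derivative of Laurent polynomials. -/
noncomputable def partialLaurent (O : Type*) [CommRing O] (i : ι) :
    AddMonoidAlgebra O (ι → ℤ) →+ AddMonoidAlgebra O (ι → ℤ) :=
  (AddMonoidHom.mulLeft (invVar O i)).comp (eulerOp O (Pi.evalAddMonoidHom (fun _ => ℤ) i))

theorem partialLaurent_apply (i : ι) (z : AddMonoidAlgebra O (ι → ℤ)) :
    partialLaurent O i z = invVar O i * eulerOp O (Pi.evalAddMonoidHom (fun _ => ℤ) i) z := rfl

theorem partialLaurent_mul (i : ι) (z w : AddMonoidAlgebra O (ι → ℤ)) :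
    partialLaurent O i (z * w) = w * partialLaurent O i z + z * partialLaurent O i w := by
  simp only [partialLaurent_apply, eulerOp_mul]
  ring

theorem X_mul_partialLaurent (i : ι) (z : AddMonoidAlgebra O (ι → ℤ)) :
    toLaurent ι O (X i) * partialLaurent O i z =
      eulerOp O (Pi.evalAddMonoidHom (fun _ => ℤ) i) z := by
  rw [partialLaurent_apply, ← mul_assoc, toLaurent_X_mul_invVar, one_mul]

theorem partialLaurent_toLaurent (i : ι) (f : MvPolynomial ι O) :
    partialLaurent O i (toLaurent ι O f) = toLaurent ι O (pderiv i f) := by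
  induction f using MvPolynomial.induction_on with
  | C c => simp [partialLaurent_apply, toLaurent_C, eulerOp_single]
  | add f g hf hg => simp [hf, hg]
  | mul_X f j hf =>
    rw [map_mul, partialLaurent_mul, hf, pderiv_mul, map_add, map_mul, map_mul,
      mul_comm (toLaurent ι O (X j))]
    congr 2
    rw [partialLaurent_apply, toLaurent_X, eulerOp_single]
    by_cases h : i = j
    · subst h
      simp [invVar, AddMonoidAlgebra.single_mul_single]
      rfl
    · simp [h, pderiv_X_of_ne (Ne.symm h)]

theorem partialLaurent_mem_loc (J : Ideal (MvPolynomial ι O)) (i : ι) (S : Finset ι) (k : ℕ)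
    (z : AddMonoidAlgebra O (ι → ℤ)) (hz : z ∈ loc (toLaurent ι O) X S (J ^ k)) :
    partialLaurent O i z ∈ loc (toLaurent ι O) X S (J ^ (k - 1)) := by
  obtain ⟨e, a, ha, h⟩ := hz
  set s : MvPolynomial ι O := ∏ j ∈ S, X j
  refine ⟨e + e, s ^ e * pderiv i a - pderiv i (s ^ e) * a, sub_mem
    (Ideal.mul_mem_left _ _ (pderiv_mem_pow J i k ha))
    (Ideal.mul_mem_left _ _ (Ideal.pow_le_pow_right (Nat.sub_le k 1) ha)), ?_⟩
  have h1 := congrArg (partialLaurent O i) h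
  rw [partialLaurent_mul, partialLaurent_toLaurent, ← map_pow, partialLaurent_toLaurent] at h1
  rw [map_sub, map_mul, map_mul, h1, h]
  simp only [map_pow]
  ring

end PartialDerivative

section BaseCocycle

variable {κ : Type*} [DecidableEq κ] {O : Type*} [CommRing O]

/-- The transition functions `(x_{z₁ w₂} / x_z) ^ q`. -/
noncomputable def baseCocycle (O : Type*) [CommRing O] (q : ℕ) (z w : κ × Fin 2) :
    AddMonoidAlgebra O (κ × Fin 2 → ℤ) :=
  (toLaurent (κ × Fin 2) O (X (z.1, w.2)) * invVar O z) ^ q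

theorem baseCocycle_self (q : ℕ) (z : κ × Fin 2) : baseCocycle O q z z = 1 := by
  rw [baseCocycle, Prod.mk.eta, toLaurent_X_mul_invVar, one_pow]

theorem invVar_mem_loc {ι : Type*} [DecidableEq ι] {S : Finset ι} {i : ι} (hi : i ∈ S) :
    invVar O i ∈ loc (toLaurent ι O) X S ⊤ :=
  mem_loc_of_mul_eq_one hi (toLaurent_X_mul_invVar i)

theorem pow_mem_loc {ι R Λ : Type*} [CommRing R] [CommRing Λ] {φ : R →+* Λ} {x : ι → R}
    {S : Finset ι} {z : Λ} (hz : z ∈ loc φ x S ⊤) (q : ℕ) : z ^ q ∈ loc φ x S ⊤ := by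
  induction q with
  | zero => rw [pow_zero]; exact one_mem_loc S
  | succ q ih => rw [pow_succ]; exact mul_mem_loc_left ih hz

theorem minor_mem {κ : Type*} {𝔞 : Ideal (MvPolynomial (κ × Fin 2) O)}
    (h : ∀ i j : κ, X (i, 0) * X (j, 1) - X (i, 1) * X (j, 0) ∈ 𝔞) (i j : κ) (s t : Fin 2) :
    (X (i, s) * X (j, t) - X (i, t) * X (j, s) : MvPolynomial (κ × Fin 2) O) ∈ 𝔞 := by
  fin_cases s <;> fin_cases t
  · simp
  · exact h i j
  · rw [← neg_mem_iff, neg_sub]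
    exact h i j
  · simp

theorem isApproxCocycle_baseCocycle {J : Ideal (MvPolynomial (κ × Fin 2) O)} {q M : ℕ}
    (hJ : ∀ i j s t, (X (i, s) * X (j, t)) ^ q - (X (i, t) * X (j, s)) ^ q ∈ J ^ M) :
    IsApproxCocycle (toLaurent (κ × Fin 2) O) X J (baseCocycle O q) M (baseCocycle O q) := by
  refine ⟨fun z w => ?_, fun z w => ?_, fun z w y => ?_⟩
  · exact pow_mem_loc (mul_mem_loc_left (map_mem_loc _ Submodule.mem_top)
      (invVar_mem_loc (by simp))) q
  · rw [sub_self]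
    exact zero_mem _
  · have h1 : invVar O w ^ q * toLaurent (κ × Fin 2) O (X w) ^ q = 1 := by
      rw [← mul_pow, mul_comm, toLaurent_X_mul_invVar, one_pow]
    have : baseCocycle O q z w * baseCocycle O q w y - baseCocycle O q z y =
        toLaurent (κ × Fin 2) O ((X (z.1, w.2) * X (w.1, y.2)) ^ q -
          (X (z.1, y.2) * X (w.1, w.2)) ^ q) * (invVar O z ^ q * invVar O w ^ q) := by
      simp only [baseCocycle, Prod.mk.eta, map_sub, map_mul, map_pow, mul_pow]
      linear_combination (toLaurent (κ × Fin 2) O (X (z.1, y.2)) ^ q * invVar O z ^ q) * h1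
    rw [this]
    exact mul_mem_loc_left (map_mem_loc _ (hJ _ _ _ _)) (mul_mem_loc_left
      (pow_mem_loc (invVar_mem_loc (by simp)) q) (pow_mem_loc (invVar_mem_loc (by simp)) q))

theorem baseCocycle_mul_swap_sub_one_mem {J : Ideal (MvPolynomial (κ × Fin 2) O)} {q M : ℕ}
    (hM : 1 ≤ M)
    (hJ : ∀ i j s t, (X (i, s) * X (j, t)) ^ q - (X (i, t) * X (j, s)) ^ q ∈ J ^ M)
    (z w : κ × Fin 2) : baseCocycle O q z w * baseCocycle O q w z - 1 ∈
      loc (toLaurent (κ × Fin 2) O) X [z, w].toFinset J := by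
  have h := (isApproxCocycle_baseCocycle hJ).mul_sub_mem_pow z w z
  rw [baseCocycle_self] at h
  exact loc_mono_left J (by intro a; simp; tauto) (loc_mono_right (Ideal.pow_le_self (by omega)) h)

end BaseCocycle

section Line

variable {κ : Type*} {O : Type*} [CommRing O]

/-- The exponents of the monomials that only involve the columns `c₀` and `c₁`. -/
def IsLineExp (c₀ c₁ : κ) (a : κ × Fin 2 → ℤ) : Prop := ∀ z, z.1 ≠ c₀ → z.1 ≠ c₁ → a z = 0

/-- The exponent of the restriction of a monomial in the columns `c₀` and `c₁` to
`(s, t) ↦ ((s, 1), t)`: the degrees in the two rows and the degree in the column `c₀`. -/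
def lineExp (c₀ c₁ : κ) : (κ × Fin 2 → ℤ) →+ ℤ × ℤ × ℤ :=
  let e (z : κ × Fin 2) := Pi.evalAddMonoidHom (fun _ : κ × Fin 2 => ℤ) z
  (e (c₀, 0) + e (c₁, 0)).prod ((e (c₀, 1) + e (c₁, 1)).prod (e (c₀, 0) + e (c₀, 1)))

theorem lineExp_apply (c₀ c₁ : κ) (a : κ × Fin 2 → ℤ) : lineExp c₀ c₁ a =
    (a (c₀, 0) + a (c₁, 0), a (c₀, 1) + a (c₁, 1), a (c₀, 0) + a (c₀, 1)) := rfl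

noncomputable instance (c₀ c₁ : κ) : DecidablePred (IsLineExp c₀ c₁) := Classical.decPred _

/-- The restriction of Laurent polynomials to the Segre embedding of `{line} × ℙ¹`. -/
noncomputable def lineMap (O : Type*) [CommRing O] (c₀ c₁ : κ) :
    AddMonoidAlgebra O (κ × Fin 2 → ℤ) →+ AddMonoidAlgebra O (ℤ × ℤ × ℤ) :=
  filterMap O (IsLineExp c₀ c₁) (lineExp c₀ c₁)

/-- The restriction of polynomials to the Segre embedding of `{line} × ℙ¹`. -/
noncomputable def lineEval [DecidableEq κ] (O : Type*) [CommRing O] (c₀ c₁ : κ) :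
    MvPolynomial (κ × Fin 2) O →+* AddMonoidAlgebra O (ℤ × ℤ × ℤ) :=
  eval₂Hom AddMonoidAlgebra.singleZeroRingHom fun z =>
    if z.1 = c₀ ∨ z.1 = c₁ then AddMonoidAlgebra.single (lineExp c₀ c₁ (Pi.single z 1)) 1 else 0

variable {c₀ c₁ : κ}

theorem isLineExp_single_iff [DecidableEq κ] {z : κ × Fin 2} :
    IsLineExp c₀ c₁ (Pi.single z 1) ↔ z.1 = c₀ ∨ z.1 = c₁ := by
  constructor
  · intro h
    by_contra! h'
    simpa using h z h'.1 h'.2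
  · intro h y h0 h1
    rw [Pi.single_eq_of_ne]
    rintro rfl
    tauto

theorem lineMap_mul {z w : AddMonoidAlgebra O (κ × Fin 2 → ℤ)}
    (hz : ∀ a, z.coeff a ≠ 0 → ∀ y : κ × Fin 2, y.1 ≠ c₀ → y.1 ≠ c₁ → 0 ≤ a y)
    (hw : ∀ a, w.coeff a ≠ 0 → ∀ y : κ × Fin 2, y.1 ≠ c₀ → y.1 ≠ c₁ → 0 ≤ a y) :
    lineMap O c₀ c₁ (z * w) = lineMap O c₀ c₁ z * lineMap O c₀ c₁ w := by
  refine filterMap_mul (N := fun a => ∀ y : κ × Fin 2, y.1 ≠ c₀ → y.1 ≠ c₁ → 0 ≤ a y)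
    (Q := IsLineExp c₀ c₁) _
    (fun a b ha hb => ⟨fun h => ⟨fun y h0 h1 => ?_, fun y h0 h1 => ?_⟩,
      fun h y h0 h1 => ?_⟩) hz hw
  · have := h y h0 h1
    have := ha y h0 h1
    have := hb y h0 h1
    simp only [Pi.add_apply] at *
    omega
  · have := h y h0 h1
    have := ha y h0 h1
    have := hb y h0 h1
    simp only [Pi.add_apply] at *
    omega
  · rw [Pi.add_apply, h.1 y h0 h1, h.2 y h0 h1, add_zero]

theorem coeff_toLaurent_nonneg {ι : Type*} {f : MvPolynomial ι O} {a : ι → ℤ}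
    (h : (toLaurent ι O f).coeff a ≠ 0) (i : ι) : 0 ≤ a i := by
  by_contra! h'
  exact h (coeff_toLaurent_of_neg f h')

theorem lineMap_single_X [DecidableEq κ] (z : κ × Fin 2) (h : z.1 = c₀ ∨ z.1 = c₁) :
    lineMap O c₀ c₁ (toLaurent _ O (X z)) =
      AddMonoidAlgebra.single (lineExp c₀ c₁ (Pi.single z 1)) 1 := by
  rw [toLaurent_X]
  exact filterMap_single_pos _ (isLineExp_single_iff.mpr h) 1

theorem lineMap_toLaurent [DecidableEq κ] (f : MvPolynomial (κ × Fin 2) O) :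
    lineMap O c₀ c₁ (toLaurent _ O f) = lineEval O c₀ c₁ f := by
  induction f using MvPolynomial.induction_on with
  | C c =>
    rw [toLaurent_C, lineEval, coe_eval₂Hom, eval₂_C, singleZeroRingHom_eq_single]
    exact (filterMap_single_pos _ (fun _ _ _ => rfl) c).trans (by rw [map_zero])
  | add f g hf hg => rw [map_add, map_add, hf, hg, map_add]
  | mul_X f z hf =>
    rw [map_mul, lineMap_mul (fun a h y _ _ => coeff_toLaurent_nonneg h y)
      (fun a h y _ _ => coeff_toLaurent_nonneg h y), hf, map_mul]
    congr 1
    rw [lineEval, coe_eval₂Hom, eval₂_X]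
    split_ifs with h
    · exact lineMap_single_X z h
    · rw [toLaurent_X]
      exact filterMap_single_neg _ (isLineExp_single_iff.not.mpr h) 1

theorem isUnit_lineEval_X [DecidableEq κ] {z : κ × Fin 2} (h : z.1 = c₀ ∨ z.1 = c₁) :
    IsUnit (lineEval O c₀ c₁ (X z)) := by
  rw [← lineMap_toLaurent, lineMap_single_X z h]
  refine IsUnit.of_mul_eq_one (AddMonoidAlgebra.single (-lineExp c₀ c₁ (Pi.single z 1)) 1) ?_
  rw [AddMonoidAlgebra.single_mul_single, add_neg_cancel, one_mul]
  rfl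

theorem coeff_nonneg_of_mem_loc [Finite κ] {S : Finset (κ × Fin 2)}
    (hS : ∀ z ∈ S, z.1 = c₀ ∨ z.1 = c₁)
    {z : AddMonoidAlgebra O (κ × Fin 2 → ℤ)} (hz : z ∈ loc (toLaurent _ O) X S ⊤)
    (a : κ × Fin 2 → ℤ) (ha : z.coeff a ≠ 0) (y : κ × Fin 2) (h0 : y.1 ≠ c₀) (h1 : y.1 ≠ c₁) :
    0 ≤ a y := by
  rw [← Ideal.map_top C, mem_loc_map_C_iff] at hz
  refine (hz a).2 ha y fun hy => ?_
  have := hS y hy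
  tauto

theorem lineMap_mul_of_mem_loc [Finite κ] {S : Finset (κ × Fin 2)}
    (hS : ∀ z ∈ S, z.1 = c₀ ∨ z.1 = c₁) {z w : AddMonoidAlgebra O (κ × Fin 2 → ℤ)}
    (hz : z ∈ loc (toLaurent _ O) X S ⊤) (hw : w ∈ loc (toLaurent _ O) X S ⊤) :
    lineMap O c₀ c₁ (z * w) = lineMap O c₀ c₁ z * lineMap O c₀ c₁ w :=
  lineMap_mul (coeff_nonneg_of_mem_loc hS hz) (coeff_nonneg_of_mem_loc hS hw)

theorem lineMap_mem [DecidableEq κ] [Finite κ] {J : Ideal (MvPolynomial (κ × Fin 2) O)}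
    {𝔬 : Ideal O}
    (hJ : J ≤ (𝔬.map AddMonoidAlgebra.singleZeroRingHom).comap (lineEval O c₀ c₁))
    {S : Finset (κ × Fin 2)} (hS : ∀ z ∈ S, z.1 = c₀ ∨ z.1 = c₁) {K : ℕ}
    {z : AddMonoidAlgebra O (κ × Fin 2 → ℤ)} (hz : z ∈ loc (toLaurent _ O) X S (J ^ K)) :
    lineMap O c₀ c₁ z ∈ (𝔬 ^ K).map AddMonoidAlgebra.singleZeroRingHom := by
  have hz' := loc_mono_right le_top hz
  obtain ⟨e, a, ha, h⟩ := hz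
  have h1 := congrArg (lineMap O c₀ c₁) h
  rw [← map_pow, lineMap_mul (fun a h y _ _ => coeff_toLaurent_nonneg h y)
    (coeff_nonneg_of_mem_loc hS hz'), lineMap_toLaurent, lineMap_toLaurent, map_pow,
    map_prod] at h1
  have hu : IsUnit ((∏ i ∈ S, lineEval O c₀ c₁ (X i)) ^ e) := by
    refine IsUnit.pow e ?_
    rw [IsUnit.prod_iff]
    exact fun i hi => isUnit_lineEval_X (hS i hi)
  rw [← Ideal.unit_mul_mem_iff_mem _ hu, ← h1, Ideal.map_pow]
  have := Ideal.le_comap_pow (lineEval O c₀ c₁) K (Ideal.pow_right_mono hJ K ha)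
  exact this

theorem eq_zero_of_lineExp_eq_zero (hc : c₀ ≠ c₁) {z : κ × Fin 2} (hz : z.1 = c₀ ∨ z.1 = c₁)
    {a : κ × Fin 2 → ℤ} (ha : lineExp c₀ c₁ a = 0) (hpos : ∀ y, y ≠ z → 0 ≤ a y)
    {ζ : κ × Fin 2} (hζ : ζ.1 = c₀ ∨ ζ.1 = c₁) : a ζ = 0 := by
  simp only [lineExp_apply, Prod.mk_eq_zero] at ha
  have h : a (c₀, 0) = 0 := by
    obtain ⟨i, s⟩ := z
    have h00 := hpos (c₀, 0)
    have h01 := hpos (c₀, 1)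
    have h10 := hpos (c₁, 0)
    have h11 := hpos (c₁, 1)
    dsimp only at hz
    rcases hz with rfl | rfl <;> fin_cases s <;> simp [hc, hc.symm] at h00 h01 h10 h11 <;> omega
  obtain ⟨j, t⟩ := ζ
  dsimp only at hζ
  rcases hζ with rfl | rfl <;> fin_cases t <;> simp <;> omega

theorem coeff_zero_lineMap_X_mul [DecidableEq κ] [Finite κ] (hc : c₀ ≠ c₁) {z ζ : κ × Fin 2}
    (hz : z.1 = c₀ ∨ z.1 = c₁) (hζ : ζ.1 = c₀ ∨ ζ.1 = c₁) (hne : ζ ≠ z)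
    {r : AddMonoidAlgebra O (κ × Fin 2 → ℤ)} (hr : r ∈ loc (toLaurent _ O) X {z} ⊤) :
    (lineMap O c₀ c₁ (toLaurent _ O (X ζ) * r)).coeff 0 = 0 := by
  rw [← Ideal.map_top C, mem_loc_map_C_iff] at hr
  refine coeff_zero_filterMap fun a _ hψ => ?_
  rw [toLaurent_X]
  by_contra hne0
  obtain ⟨b, hb, rfl⟩ : ∃ b, r.coeff b ≠ 0 ∧ Pi.single ζ 1 + b = a := by
    refine ⟨-Pi.single ζ 1 + a, ?_, by abel⟩
    rw [AddMonoidAlgebra.coeff_single_mul_eq_mul_coeff (-Pi.single ζ 1 + a)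
      (fun b _ => by rw [eq_neg_add_iff_add_eq]), one_mul] at hne0
    exact hne0
  have hb' : ∀ i, i ≠ z → 0 ≤ b i := fun i hi => (hr b).2 hb i (by simpa using hi)
  have hs : ∀ i, 0 ≤ (Pi.single ζ 1 : κ × Fin 2 → ℤ) i := fun i =>
    (Pi.single_nonneg.mpr zero_le_one : (0 : κ × Fin 2 → ℤ) ≤ Pi.single ζ 1) i
  have := eq_zero_of_lineExp_eq_zero hc hz hψ (fun y hy => add_nonneg (hs y) (hb' y hy)) hζ
  rw [Pi.add_apply, Pi.single_eq_same] at this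
  have := hb' ζ hne
  omega

end Line

section LineObstruction

variable {κ : Type*} [DecidableEq κ] {O : Type*} [CommRing O] {c₀ c₁ : κ}
  {J : Ideal (MvPolynomial (κ × Fin 2) O)} {𝔬 : Ideal O} {q K : ℕ}

theorem eulerOp_mem_loc {z : AddMonoidAlgebra O (κ × Fin 2 → ℤ)} {S : Finset (κ × Fin 2)}
    (ζ : κ × Fin 2) (hz : z ∈ loc (toLaurent _ O) X S ⊤) :
    eulerOp O (Pi.evalAddMonoidHom (fun _ => ℤ) ζ) z ∈ loc (toLaurent _ O) X S ⊤ := by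
  rw [← X_mul_partialLaurent]
  have := partialLaurent_mem_loc (⊤ : Ideal (MvPolynomial (κ × Fin 2) O)) ζ S 0 z
    (by simpa using hz)
  exact mul_mem_loc_left (map_mem_loc S Submodule.mem_top) (by simpa using this)

theorem coeff_zero_lineMap_mul_eulerOp_sub_mem [Finite κ]
    (hJ : J ≤ (𝔬.map AddMonoidAlgebra.singleZeroRingHom).comap (lineEval O c₀ c₁))
    {z w ζ : κ × Fin 2} (hz : z.1 = c₀ ∨ z.1 = c₁) (hw : w.1 = c₀ ∨ w.1 = c₁)
    {a b r s : AddMonoidAlgebra O (κ × Fin 2 → ℤ)}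
    (h : b * partialLaurent O ζ a - (s - r) ∈ loc (toLaurent _ O) X [z, w].toFinset (J ^ K)) :
    (lineMap O c₀ c₁ (b * eulerOp O (Pi.evalAddMonoidHom (fun _ => ℤ) ζ) a)).coeff 0 -
      ((lineMap O c₀ c₁ (toLaurent _ O (X ζ) * s)).coeff 0 -
        (lineMap O c₀ c₁ (toLaurent _ O (X ζ) * r)).coeff 0) ∈ 𝔬 ^ K := by
  have h1 := mul_mem_loc_right (map_mem_loc _
    (show (X ζ : MvPolynomial (κ × Fin 2) O) ∈ (⊤ : Ideal _) from Submodule.mem_top)) h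
  have h2 := lineMap_mem hJ (by simp [hz, hw]) h1
  have h3 : toLaurent _ O (X ζ) * (b * partialLaurent O ζ a - (s - r)) =
      b * eulerOp O (Pi.evalAddMonoidHom (fun _ => ℤ) ζ) a -
        (toLaurent _ O (X ζ) * s - toLaurent _ O (X ζ) * r) := by
    rw [← X_mul_partialLaurent]
    ring
  rw [h3, map_sub, map_sub] at h2
  simpa using (mem_map_singleZero_iff _ _).mp h2 0

theorem natCast_mem_pow_of_logDeriv [Finite κ] [IsDomain O] [CharZero O] {p : ℕ} (hp : p.Prime)
    (hp𝔬 : (p : O) ∈ 𝔬) (hc : c₀ ≠ c₁)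
    (hJ : J ≤ (𝔬.map AddMonoidAlgebra.singleZeroRingHom).comap (lineEval O c₀ c₁))
    {g g' : κ × Fin 2 → κ × Fin 2 → AddMonoidAlgebra O (κ × Fin 2 → ℤ)}
    (hg : ∀ z w, g z w ∈ loc (toLaurent _ O) X [z, w].toFinset ⊤)
    (hg₀ : ∀ z w, g z w - baseCocycle O q z w ∈ loc (toLaurent _ O) X [z, w].toFinset J)
    (hg' : ∀ z w, g' z w ∈ loc (toLaurent _ O) X [z, w].toFinset ⊤)
    (hgg' : ∀ z w, g z w * g' z w - 1 ∈ loc (toLaurent _ O) X [z, w].toFinset (J ^ K))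
    {ω : κ × Fin 2 → κ × Fin 2 → AddMonoidAlgebra O (κ × Fin 2 → ℤ)}
    (hω : ∀ ζ z, ω ζ z ∈ loc (toLaurent _ O) X {z} ⊤)
    (h : ∀ ζ z w, g' z w * partialLaurent O ζ (g z w) - (ω ζ w - ω ζ z) ∈
      loc (toLaurent _ O) X [z, w].toFinset (J ^ K)) : (q : O) ∈ 𝔬 ^ K := by
  set ev := lineMap O c₀ c₁
  set E : κ × Fin 2 → _ := fun ζ => eulerOp O (Pi.evalAddMonoidHom (fun _ => ℤ) ζ)
  set α := (ev (toLaurent _ O (X (c₀, 0)) * ω (c₀, 0) (c₀, 0))).coeff 0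
  -- the constant terms of the logarithmic derivatives along the two diagonals
  have key : ∀ (w ζ : κ × Fin 2), (w.1 = c₀ ∨ w.1 = c₁) → (ζ.1 = c₀ ∨ ζ.1 = c₁) →
      w ≠ (c₀, 0) → ζ ≠ (c₀, 0) → ζ ≠ w →
      (ev (g' (c₀, 0) w * (E (c₀, 0) + E ζ) (g (c₀, 0) w))).coeff 0 + α ∈ 𝔬 ^ K := by
    intro w ζ hw hζ hw0 hζ0 hζw
    have h1 := coeff_zero_lineMap_mul_eulerOp_sub_mem hJ (Or.inl rfl) hw (h (c₀, 0) (c₀, 0) w)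
    have h2 := coeff_zero_lineMap_mul_eulerOp_sub_mem hJ (Or.inl rfl) hw (h ζ (c₀, 0) w)
    rw [coeff_zero_lineMap_X_mul hc hw (Or.inl rfl) hw0.symm (hω _ _), zero_sub,
      sub_neg_eq_add] at h1
    rw [coeff_zero_lineMap_X_mul hc hw hζ hζw (hω _ _),
      coeff_zero_lineMap_X_mul hc (Or.inl rfl) hζ hζ0 (hω _ _), sub_zero, sub_zero] at h2
    have := add_mem h1 h2
    rw [AddMonoidHom.add_apply, mul_add, map_add, AddMonoidAlgebra.coeff_add, Finsupp.add_apply]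
    convert this using 1
    ring
  have hmul : ∀ (w ζ : κ × Fin 2) (χ : ℤ × ℤ × ℤ →+ ℤ), (w.1 = c₀ ∨ w.1 = c₁) →
      (Pi.evalAddMonoidHom (fun _ => ℤ) (c₀, 0) + Pi.evalAddMonoidHom (fun _ => ℤ) ζ =
        χ.comp (lineExp c₀ c₁)) →
      ev (g' (c₀, 0) w * (E (c₀, 0) + E ζ) (g (c₀, 0) w)) =
        ev (g' (c₀, 0) w) * eulerOp O χ (ev (g (c₀, 0) w)) := by
    intro w ζ χ hw hχ
    have hE : (E (c₀, 0) + E ζ) (g (c₀, 0) w) =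
        eulerOp O (χ.comp (lineExp c₀ c₁)) (g (c₀, 0) w) := by
      rw [← hχ, eulerOp_add]
      rfl
    have hmem : (E (c₀, 0) + E ζ) (g (c₀, 0) w) ∈ loc (toLaurent _ O) X [(c₀, 0), w].toFinset ⊤ :=
      add_mem (eulerOp_mem_loc _ (hg _ _)) (eulerOp_mem_loc _ (hg _ _))
    refine (lineMap_mul_of_mem_loc (by simp [hw]) (hg' _ _) hmem).trans ?_
    rw [hE]
    congr 1
    exact filterMap_eulerOp _ _ _ _
  have hinv : ∀ w : κ × Fin 2, (w.1 = c₀ ∨ w.1 = c₁) →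
      ev (g' (c₀, 0) w) * ev (g (c₀, 0) w) - 1 ∈
        (𝔬 ^ K).map AddMonoidAlgebra.singleZeroRingHom := by
    intro w hw
    have h1 := lineMap_mem hJ (by simp [hw]) (hgg' (c₀, 0) w)
    rw [map_sub, lineMap_mul_of_mem_loc (S := [(c₀, 0), w].toFinset) (by simp [hw]) (hg _ _)
      (hg' _ _), mul_comm, ← map_one (toLaurent (κ × Fin 2) O), lineMap_toLaurent, map_one] at h1
    exact h1
  have hbase : ∀ w : κ × Fin 2, (w.1 = c₀ ∨ w.1 = c₁) →
      ev (g (c₀, 0) w) - ev (baseCocycle O q (c₀, 0) w) ∈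
        𝔬.map AddMonoidAlgebra.singleZeroRingHom := by
    intro w hw
    have h1 := hg₀ (c₀, 0) w
    rw [← pow_one J] at h1
    have h2 := lineMap_mem hJ (by simp [hw]) h1
    rwa [map_sub, pow_one] at h2
  have hα : α ∈ 𝔬 ^ K := by
    have hw : ((c₁, 0) : κ × Fin 2).1 = c₀ ∨ ((c₁, 0) : κ × Fin 2).1 = c₁ := Or.inr rfl
    have h1 := key (c₁, 0) (c₀, 1) hw (Or.inl rfl) (by simp [hc.symm]) (by simp) (by simp)
    rw [hmul (c₁, 0) (c₀, 1) ((AddMonoidHom.snd ℤ ℤ).comp (AddMonoidHom.snd ℤ (ℤ × ℤ))) hw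
      rfl] at h1
    have h2 : ev (baseCocycle O q (c₀, 0) (c₁, 0)) = 1 := by
      have : baseCocycle O q (c₀, 0) (c₁, 0) = 1 := by
        rw [baseCocycle, toLaurent_X_mul_invVar, one_pow]
      rw [this, ← map_one (toLaurent (κ × Fin 2) O), lineMap_toLaurent, map_one]
    have h3 := hbase (c₁, 0) hw
    rw [h2] at h3
    have h4 := coeff_zero_mul_eulerOp_mem hp hp𝔬
      ((AddMonoidHom.snd ℤ ℤ).comp (AddMonoidHom.snd ℤ (ℤ × ℤ))) h3 (hinv _ hw)
    exact (add_mem_cancel_left h4).mp h1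
  have hw : ((c₁, 1) : κ × Fin 2).1 = c₀ ∨ ((c₁, 1) : κ × Fin 2).1 = c₁ := Or.inr rfl
  have h1 := key (c₁, 1) (c₁, 0) hw (Or.inr rfl) (by simp) (by simp [hc.symm]) (by simp)
  rw [hmul (c₁, 1) (c₁, 0) (AddMonoidHom.fst ℤ (ℤ × ℤ)) hw rfl, add_mem_cancel_right hα] at h1
  set a := ev (g (c₀, 0) (c₁, 1))
  set b := ev (g' (c₀, 0) (c₁, 1))
  set e : ℤ × ℤ × ℤ := (-q, q, 0) with he
  set μ : AddMonoidAlgebra O (ℤ × ℤ × ℤ) := AddMonoidAlgebra.single e 1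
  set ν : AddMonoidAlgebra O (ℤ × ℤ × ℤ) := AddMonoidAlgebra.single (-e) 1
  have hμν : ν * μ = 1 := by
    rw [AddMonoidAlgebra.single_mul_single, neg_add_cancel, one_mul]
    rfl
  have h2 : ev (baseCocycle O q (c₀, 0) (c₁, 1)) = μ := by
    have : baseCocycle O q (c₀, 0) (c₁, 1) =
        AddMonoidAlgebra.single (q • (Pi.single (c₀, 1) 1 + -Pi.single (c₀, 0) 1)) 1 := by
      rw [baseCocycle, toLaurent_X, invVar, AddMonoidAlgebra.single_mul_single,
        AddMonoidAlgebra.single_pow, one_mul, one_pow]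
    rw [this]
    refine (filterMap_single_pos _ (fun y h0 _ => ?_) 1).trans ?_
    · have hs : ∀ i : Fin 2, (Pi.single (c₀, i) 1 : κ × Fin 2 → ℤ) y = 0 := fun i =>
        Pi.single_eq_of_ne (by rintro rfl; exact h0 rfl) 1
      simp [hs]
    · congr 1
      rw [map_nsmul, map_add, map_neg, lineExp_apply, lineExp_apply]
      simp [hc.symm, he]
  have h3 : ν * a - 1 ∈ 𝔬.map AddMonoidAlgebra.singleZeroRingHom := by
    have := Ideal.mul_mem_left _ ν (hbase _ hw)
    rwa [h2, mul_sub, hμν] at this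
  have h4 : b * μ * (ν * a) - 1 ∈ (𝔬 ^ K).map AddMonoidAlgebra.singleZeroRingHom := by
    have : b * μ * (ν * a) = b * a * (ν * μ) := by ring
    rw [this, hμν, mul_one]
    exact hinv _ hw
  have h5 := coeff_zero_mul_eulerOp_mem hp hp𝔬 (AddMonoidHom.fst ℤ (ℤ × ℤ)) h3 h4
  have h6 : b * μ * eulerOp O (AddMonoidHom.fst ℤ (ℤ × ℤ)) (ν * a) =
      b * eulerOp O (AddMonoidHom.fst ℤ (ℤ × ℤ)) a + (q : ℤ) • (b * a - 1 + 1) := by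
    have hν : eulerOp O (AddMonoidHom.fst ℤ (ℤ × ℤ)) ν = (q : ℤ) • ν := by
      rw [eulerOp_single]
      congr 1
      simp [he]
    rw [eulerOp_mul, hν, zsmul_eq_mul, zsmul_eq_mul]
    linear_combination (((q : ℤ) : AddMonoidAlgebra O (ℤ × ℤ × ℤ)) * (b * a) +
      b * eulerOp O (AddMonoidHom.fst ℤ (ℤ × ℤ)) a) * hμν
  have h7 := (mem_map_singleZero_iff _ _).mp (hinv _ hw) 0
  rw [h6, AddMonoidAlgebra.coeff_add, Finsupp.add_apply, add_mem_cancel_left h1,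
    AddMonoidAlgebra.coeff_smul, Finsupp.smul_apply, AddMonoidAlgebra.coeff_add,
    Finsupp.add_apply, AddMonoidAlgebra.coeff_one_zero, zsmul_eq_mul, mul_add, mul_one,
    add_mem_cancel_left (Ideal.mul_mem_left _ _ h7), Int.cast_natCast] at h5
  exact h5

end LineObstruction

theorem not_forall_minor_mem_radical {O : Type u} [CommRing O] [IsDomain O] [IsNoetherianRing O]
    [CharZero O] {𝔬 : Ideal O} (h𝔬 : 𝔬 ≠ ⊤) {p : ℕ} (hp : p.Prime) (hp𝔬 : (p : O) ∈ 𝔬) {n t : ℕ}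
    {c₀ c₁ : Fin n} (hc : c₀ ≠ c₁) (f : Fin t → MvPolynomial (Fin n × Fin 2) O)
    (ht : t + 4 ≤ 2 * n)
    (hf : ∀ l, lineEval O c₀ c₁ (f l) ∈ 𝔬.map AddMonoidAlgebra.singleZeroRingHom) :
    ¬ ∀ i j : Fin n, (X (i, 0) * X (j, 1) - X (i, 1) * X (j, 0)) ∈
      (𝔬.map C ⊔ Ideal.span (Set.range f)).radical := by
  intro hminor
  set J := 𝔬.map C ⊔ Ideal.span (Set.range f)
  have hcard : Fintype.card (Fin n × Fin 2) = 2 * n := by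
    rw [Fintype.card_prod, Fintype.card_fin, Fintype.card_fin, mul_comm]
  have hJ₁ : UniformlyExact (toLaurent _ O) X J 1 := uniformlyExact_of_add_le 𝔬 t f 1 (by omega)
  have hJ₂ : UniformlyExact (toLaurent _ O) X J 2 := uniformlyExact_of_add_le 𝔬 t f 2 (by omega)
  have hJ : J ≤ (𝔬.map AddMonoidAlgebra.singleZeroRingHom).comap (lineEval O c₀ c₁) := by
    refine sup_le (Ideal.map_le_iff_le_comap.mpr fun c hc => ?_) (Ideal.span_le.mpr ?_)
    · rw [Ideal.mem_comap, Ideal.mem_comap, lineEval, coe_eval₂Hom, eval₂_C]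
      exact Ideal.mem_map_of_mem _ hc
    · rintro _ ⟨l, rfl⟩
      exact hf l
  have hpJ : (p : MvPolynomial (Fin n × Fin 2) O) ∈ J := by
    have := Ideal.mem_map_of_mem (C (σ := Fin n × Fin 2)) hp𝔬
    rw [map_natCast] at this
    exact Ideal.mem_sup_left this
  obtain ⟨M₀, hM₀⟩ := exists_isApproxCocycle hJ₂
  obtain ⟨e, he⟩ := exists_pow_prime_pow_sub_mem hp hpJ (M₀ + 1)
  have hpow : ∀ (i j : Fin n) (s t : Fin 2), (X (i, s) * X (j, t)) ^ p ^ e -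
      (X (i, t) * X (j, s)) ^ p ^ e ∈ J ^ (M₀ + 1) :=
    fun i j s t => he _ _ (minor_mem hminor i j s t)
  have hbase := isApproxCocycle_baseCocycle hpow
  have hswap := baseCocycle_mul_swap_sub_one_mem (by omega) hpow
  obtain ⟨c, hc'⟩ := exists_logDeriv_primitive (g₀ := baseCocycle O (p ^ e)) hJ₁
  have hq : ((p ^ e : ℕ) : O) ∈ ⨅ K, 𝔬 ^ K := by
    rw [Ideal.mem_iInf]
    intro K
    obtain ⟨g, hg⟩ := hM₀ _ hswap (hbase.mono (by omega)) (K + 1 + c)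
    obtain ⟨g', hg', hgg'⟩ := hg.exists_inverse hbase.mem hswap (K + 1 + c)
    choose ω hω hωg using fun ζ => hc' (K + 1 + c) g g' (partialLaurent O ζ)
      (partialLaurent_mul ζ) (partialLaurent_mem_loc J ζ) hg hg' hgg'
    have hK : K + 1 + c - 1 - c = K := by omega
    rw [hK] at hωg
    exact natCast_mem_pow_of_logDeriv hp hp𝔬 hc hJ hg.mem hg.sub_base_mem hg'
      (fun z w => loc_mono_right (Ideal.pow_le_pow_right (by omega)) (hgg' z w)) hω hωg
  rw [Ideal.iInf_pow_eq_bot_of_isDomain 𝔬 h𝔬, Ideal.mem_bot, Nat.cast_eq_zero] at hq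
  exact (pow_pos hp.pos e).ne' hq

section SpreadingOut

theorem isJacobsonRing_int : IsJacobsonRing ℤ := by
  rw [isJacobsonRing_iff_prime_eq]
  intro P hP
  by_cases h : P = ⊥
  · subst h
    refine le_antisymm (fun x hx => ?_) Ideal.le_jacobson
    by_contra hx0
    obtain ⟨p, hxp, hp⟩ := Nat.exists_infinite_primes (x.natAbs + 1)
    have hmax : (Ideal.span {(p : ℤ)}).IsMaximal :=
      PrincipalIdealRing.isMaximal_of_irreducible (Nat.prime_iff_prime_int.mp hp).irreducible
    have h1 : x ∈ Ideal.span {(p : ℤ)} := Ideal.mem_sInf.mp hx ⟨bot_le, hmax⟩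
    rw [Ideal.mem_span_singleton] at h1
    have := Int.natAbs_dvd_natAbs.mpr h1
    have := Nat.le_of_dvd (Int.natAbs_pos.mpr hx0) this
    simp at this
    omega
  · have := hP.isMaximal h
    exact Ideal.jacobson_eq_self_of_isMaximal

theorem exists_prime_natCast_mem {σ : Type*} [Finite σ] (𝔬 : Ideal (MvPolynomial σ ℤ))
    [𝔬.IsMaximal] : ∃ p : ℕ, p.Prime ∧ (p : MvPolynomial σ ℤ) ∈ 𝔬 := by
  let _ := Ideal.Quotient.field 𝔬
  let K := MvPolynomial σ ℤ ⧸ 𝔬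
  have := isJacobsonRing_int
  have hint : Algebra.IsIntegral ℤ K := ⟨fun x => by
    have := comp_C_integral_of_surjective_of_isJacobsonRing (Ideal.Quotient.mk 𝔬)
      Ideal.Quotient.mk_surjective x
    rwa [RingHom.ext_int ((Ideal.Quotient.mk 𝔬).comp C) (algebraMap ℤ K)] at this⟩
  obtain ⟨p, hp⟩ := CharP.exists K
  refine ⟨p, ?_, ?_⟩
  · refine (CharP.char_is_prime_or_zero K p).resolve_right ?_
    rintro rfl
    have := CharP.charP_to_charZero K
    exact Int.not_isField (isField_of_isIntegral_of_isField (S := K)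
      (algebraMap ℤ K).injective_int (Field.toIsField K))
  · rw [← Ideal.Quotient.eq_zero_iff_mem, map_natCast]
    exact CharP.cast_eq_zero K p

theorem map_lineEval {O O' : Type*} [CommRing O] [CommRing O'] {κ : Type*} [DecidableEq κ]
    (c₀ c₁ : κ) (θ : O →+* O') (f : MvPolynomial (κ × Fin 2) O) :
    AddMonoidAlgebra.mapRingHom _ θ (lineEval O c₀ c₁ f) = lineEval O' c₀ c₁ (map θ f) := by
  induction f using MvPolynomial.induction_on with
  | C c => simp [lineEval]
  | add f g hf hg => rw [map_add, map_add, map_add, map_add, hf, hg]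
  | mul_X f z hf =>
    rw [map_mul, map_mul, map_mul, map_mul, hf, map_X]
    congr 1
    rw [lineEval, lineEval, coe_eval₂Hom, coe_eval₂Hom, eval₂_X, eval₂_X]
    split_ifs
    · simp
    · simp

theorem not_forall_minor_mem_radical_span {k : Type u} [Field k] {n t : ℕ} {c₀ c₁ : Fin n}
    (hc : c₀ ≠ c₁) (f : Fin t → MvPolynomial (Fin n × Fin 2) k) (ht : t + 4 ≤ 2 * n)
    (hf : ∀ l, lineEval k c₀ c₁ (f l) = 0) :
    ¬ ∀ i j : Fin n, (X (i, 0) * X (j, 1) - X (i, 1) * X (j, 0)) ∈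
      (Ideal.span (Set.range f)).radical := by
  classical
  intro hminor
  choose E hE using hminor
  choose c hcE using fun i j => Ideal.mem_span_range_iff_exists_fun.mp (hE i j)
  let T : Finset k := (Finset.univ.biUnion fun l => (f l).coeffs) ∪
    Finset.univ.biUnion fun i => Finset.univ.biUnion fun j => Finset.univ.biUnion fun l =>
      (c i j l).coeffs
  let O := MvPolynomial T ℤ
  let θ : O →+* k := eval₂Hom (Int.castRingHom k) Subtype.val
  have hθ : ∀ x ∈ T, x ∈ Set.range θ := fun x hx => ⟨X ⟨x, hx⟩, eval₂_X _ _ _⟩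
  have hlift : ∀ g : MvPolynomial (Fin n × Fin 2) k, g.coeffs ⊆ T →
      ∃ g' : MvPolynomial (Fin n × Fin 2) O, map θ g' = g := by
    intro g hg
    have : g ∈ (map (σ := Fin n × Fin 2) θ).range :=
      mem_range_map_iff_coeffs_subset.mpr fun x hx => hθ x (hg hx)
    exact this
  choose f' hf' using fun l => hlift (f l) (fun x hx => Finset.mem_union_left _
    (Finset.mem_biUnion.mpr ⟨l, Finset.mem_univ _, hx⟩))
  choose c' hc' using fun i j l => hlift (c i j l) (fun x hx => Finset.mem_union_right _
    (Finset.mem_biUnion.mpr ⟨i, Finset.mem_univ _, Finset.mem_biUnion.mpr ⟨j, Finset.mem_univ _,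
      Finset.mem_biUnion.mpr ⟨l, Finset.mem_univ _, hx⟩⟩⟩))
  obtain ⟨𝔬, h𝔬, hker⟩ := Ideal.exists_le_maximal (RingHom.ker θ) (RingHom.ker_ne_top θ)
  obtain ⟨p, hp, hp𝔬⟩ := exists_prime_natCast_mem 𝔬
  refine not_forall_minor_mem_radical h𝔬.ne_top hp hp𝔬 hc f' ht (fun l => ?_) (fun i j => ?_)
  · rw [mem_map_singleZero_iff]
    intro a
    refine hker ?_
    have h1 := map_lineEval c₀ c₁ θ (f' l)
    rw [hf', hf] at h1
    have h2 := congrArg (fun z => z.coeff a) h1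
    simpa [RingHom.mem_ker] using h2
  · refine ⟨E i j, ?_⟩
    set m : MvPolynomial (Fin n × Fin 2) O := X (i, 0) * X (j, 1) - X (i, 1) * X (j, 0)
    have h1 : m ^ E i j - ∑ l, c' i j l * f' l ∈ (RingHom.ker θ).map C := by
      rw [← ker_map, RingHom.mem_ker]
      simp only [m, map_sub, map_pow, map_mul, map_sum, map_X, hf', hc']
      rw [← hcE, sub_self]
    rw [← sub_add_cancel (m ^ E i j) (∑ l, c' i j l * f' l)]
    refine add_mem (Ideal.mem_sup_left (Ideal.map_mono hker h1)) (Ideal.mem_sup_right ?_)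
    exact sum_mem fun l _ => Ideal.mul_mem_left _ _ (Ideal.subset_span ⟨l, rfl⟩)

end SpreadingOut

section MinorSums

variable {K : Type*} [CommRing K] {n : ℕ}

/-- The sum of the `2 × 2` minors of the matrix with rows `u` and `v` whose columns have indices
with sum `s`. -/
def minorSum (u v : Fin (n + 1) → K) (s : ℕ) : K :=
  ∑ ij : Fin (n + 1) × Fin (n + 1) with ij.1 < ij.2 ∧ (ij.1 : ℕ) + ij.2 = s,
    (u ij.1 * v ij.2 - u ij.2 * v ij.1)

theorem map_minorSum {L : Type*} [CommRing L] (ψ : K →+* L) (u v : Fin (n + 1) → K) (s : ℕ) :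
    ψ (minorSum u v s) = minorSum (fun i => ψ (u i)) (fun i => ψ (v i)) s := by
  simp [minorSum, map_sum]

theorem minorSum_eq_of_forall (u v : Fin (n + 1) → K) {a b : Fin (n + 1)} (hab : a < b)
    (h : ∀ i j : Fin (n + 1), i < j → (i : ℕ) + j = a + b → i ≠ a → u i * v j = u j * v i) :
    minorSum u v (a + b) = u a * v b - u b * v a := by
  refine Finset.sum_eq_single_of_mem (a, b) (by simp [hab]) ?_
  rintro ⟨i, j⟩ hij hne
  simp only [Finset.mem_filter, Finset.mem_univ, true_and] at hij
  refine sub_eq_zero.mpr (h i j hij.1 hij.2 ?_)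
  rintro rfl
  exact hne (Prod.ext rfl (Fin.ext (by simpa using hij.2)))

variable [IsDomain K]

theorem mul_eq_mul_of_column {u v : Fin (n + 1) → K} {c a b : Fin (n + 1)}
    (hc : u c ≠ 0 ∨ v c ≠ 0) (ha : u c * v a = u a * v c) (hb : u c * v b = u b * v c) :
    u a * v b = u b * v a := by
  rcases hc with hc | hc
  · refine mul_left_cancel₀ hc ?_
    linear_combination u a * hb - u b * ha
  · refine mul_left_cancel₀ hc ?_
    linear_combination v a * hb - v b * ha

theorem mul_eq_mul_of_minorSum_eq_zero (hn : 2 ≤ n) {u v : Fin (n + 1) → K}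
    (hs : ∀ s, 1 ≤ s → s ≤ 2 * n - 3 → minorSum u v s = 0)
    (hlast : (∀ i : Fin (n + 1), (i : ℕ) < n - 2 → u i = 0 ∧ v i = 0) →
      u (Fin.last n) = 0 ∧ v (Fin.last n) = 0) (i j : Fin (n + 1)) :
    u i * v j = u j * v i := by
  by_cases h : ∃ m, ∃ c : Fin (n + 1), (c : ℕ) = m ∧ m < n - 2 ∧ (u c ≠ 0 ∨ v c ≠ 0)
  · classical
    obtain ⟨c, hcm, hcn, hc⟩ := Nat.find_spec h
    have hlt : ∀ i : Fin (n + 1), i < c → u i = 0 ∧ v i = 0 := by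
      intro i hi
      have hi' : (i : ℕ) < c := hi
      have := Nat.find_min h (hcm ▸ hi')
      by_contra h'
      exact this ⟨i, rfl, by omega, by tauto⟩
    have hcol : ∀ m, ∀ a : Fin (n + 1), (a : ℕ) = m → u c * v a = u a * v c := by
      intro m
      induction m using Nat.strong_induction_on with
      | _ m ih =>
        rintro a rfl
        rcases lt_trichotomy a c with hac | rfl | hac
        · rw [(hlt a hac).1, (hlt a hac).2, mul_zero, zero_mul]
        · rfl
        · have hac' : (c : ℕ) < a := hac
          have ha := a.is_le
          have h1 := hs (c + a) (by omega) (by omega)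
          rw [minorSum_eq_of_forall u v hac, sub_eq_zero] at h1
          · exact h1
          · intro i j hij hsum hic
            have hij' : (i : ℕ) < j := hij
            rcases lt_or_gt_of_ne hic with hic | hic
            · rw [(hlt i hic).1, (hlt i hic).2, mul_zero, zero_mul]
            · have hic' : (c : ℕ) < i := hic
              exact mul_eq_mul_of_column hc (ih i (by omega) i rfl) (ih j (by omega) j rfl)
    exact mul_eq_mul_of_column hc (hcol i i rfl) (hcol j j rfl)
  · have hzero : ∀ i : Fin (n + 1), (i : ℕ) < n - 2 → u i = 0 ∧ v i = 0 := by
      intro i hi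
      by_contra h'
      exact h ⟨i, i, rfl, hi, by tauto⟩
    have hz : ∀ i : Fin (n + 1), (i : ℕ) < n - 2 ∨ (i : ℕ) = n → u i = 0 ∧ v i = 0 := by
      rintro i (hi | hi)
      · exact hzero i hi
      · rw [show i = Fin.last n from Fin.ext hi]
        exact hlast hzero
    have hcase : ∀ i : Fin (n + 1), ((i : ℕ) < n - 2 ∨ (i : ℕ) = n) ∨ (i : ℕ) = n - 2 ∨
        (i : ℕ) = n - 1 := fun i => by have := i.is_le; omega
    have hmid : u ⟨n - 2, by omega⟩ * v ⟨n - 1, by omega⟩ =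
        u ⟨n - 1, by omega⟩ * v ⟨n - 2, by omega⟩ := by
      have h1 := hs ((⟨n - 2, by omega⟩ : Fin (n + 1)) + (⟨n - 1, by omega⟩ : Fin (n + 1)) : ℕ)
        (by simp; omega) (by simp; omega)
      rwa [minorSum_eq_of_forall u v (Fin.mk_lt_mk.mpr (by omega)), sub_eq_zero] at h1
      intro i j hij hsum hne
      have hij' : (i : ℕ) < j := hij
      have hne' : (i : ℕ) ≠ n - 2 := fun h => hne (Fin.ext h)
      dsimp only at hsum
      obtain ⟨h1, h2⟩ := hz i (by have := j.is_le; omega)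
      rw [h1, h2, mul_zero, zero_mul]
    rcases hcase i with hi | hi
    · rw [(hz i hi).1, (hz i hi).2, mul_zero, zero_mul]
    rcases hcase j with hj | hj
    · rw [(hz j hj).1, (hz j hj).2, mul_zero, zero_mul]
    have e2 : ∀ i : Fin (n + 1), (i : ℕ) = n - 2 → i = ⟨n - 2, by omega⟩ := fun i h => Fin.ext h
    have e1 : ∀ i : Fin (n + 1), (i : ℕ) = n - 1 → i = ⟨n - 1, by omega⟩ := fun i h => Fin.ext h
    rcases hi with hi | hi <;> rcases hj with hj | hj
    · rw [e2 i hi, e2 j hj]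
    · rw [e2 i hi, e1 j hj, hmid]
    · rw [e1 i hi, e2 j hj, hmid]
    · rw [e1 i hi, e1 j hj]

end MinorSums

section Segre

variable {k : Type u} [Field k] {n : ℕ}

theorem aeval_mul_of_isHomogeneous {σ R A : Type*} [CommRing R] [CommRing A] [Algebra R A]
    {F : MvPolynomial σ R} {d : ℕ} (hF : F.IsHomogeneous d) (a : A) (x : σ → A) :
    aeval (fun i => a * x i) F = a ^ d * aeval x F := by
  simp only [aeval_def, eval₂_eq, Finset.mul_sum]
  refine Finset.sum_congr rfl fun m hm => ?_
  have hd : ∑ i ∈ m.support, m i = d := (hF.degree_eq_sum_deg_support hm).symm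
  simp only [mul_pow, Finset.prod_mul_distrib, Finset.prod_pow_eq_pow_sum, hd]
  ring

/-- The Segre embedding of coordinate rings, before passing to quotients. -/
noncomputable def segreHom (k : Type u) [Field k] (n : ℕ) :
    MvPolynomial (Fin (n + 1) × Fin 2) k →ₐ[k] MvPolynomial (Fin (n + 1) ⊕ Fin 2) k :=
  aeval fun p => X (Sum.inl p.1) * X (Sum.inr p.2)

theorem mem_segreIdeal_iff {F : MvPolynomial (Fin (n + 1)) k}
    {g : MvPolynomial (Fin (n + 1) × Fin 2) k} :
    g ∈ segreIdeal k n 1 (Ideal.span {F}) ⊥ ↔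
      segreHom k n g ∈ Ideal.span {rename (Sum.inl : Fin (n + 1) → Fin (n + 1) ⊕ Fin 2) F} := by
  have h : (Ideal.span {F}).map (rename (Sum.inl : Fin (n + 1) → Fin (n + 1) ⊕ Fin (1 + 1))) ⊔
      (⊥ : Ideal (MvPolynomial (Fin (1 + 1)) k)).map
        (rename (Sum.inr : Fin (1 + 1) → Fin (n + 1) ⊕ Fin (1 + 1))) =
      Ideal.span {rename (Sum.inl : Fin (n + 1) → Fin (n + 1) ⊕ Fin 2) F} := by
    rw [Ideal.map_bot, sup_bot_eq, Ideal.map_span, Set.image_singleton]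
  rw [segreIdeal, RingHom.mem_ker, ← h, ← Ideal.Quotient.eq_zero_iff_mem]
  refine iff_of_eq (congrArg (· = 0) ?_)
  exact DFunLike.congr_fun (algHom_ext (g := (Ideal.Quotient.mkₐ k _).comp (segreHom k n))
    fun p => by simp [segreHom]) g

theorem map_segreHom_eq_zero {A : Type*} [CommRing A] [Algebra k A]
    {F : MvPolynomial (Fin (n + 1)) k} {x : Fin (n + 1) → A} {y : Fin 2 → A} (hx : aeval x F = 0)
    {g : MvPolynomial (Fin (n + 1) × Fin 2) k} (hg : g ∈ segreIdeal k n 1 (Ideal.span {F}) ⊥) :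
    aeval (fun p : Fin (n + 1) × Fin 2 => x p.1 * y p.2) g = 0 := by
  obtain ⟨q, hq⟩ := Ideal.mem_span_singleton.mp (mem_segreIdeal_iff.mp hg)
  have h : aeval (fun p : Fin (n + 1) × Fin 2 => x p.1 * y p.2) g =
      aeval (Sum.elim x y) (segreHom k n g) :=
    DFunLike.congr_fun (algHom_ext (g := (aeval (Sum.elim x y)).comp (segreHom k n))
      fun p => by simp [segreHom]) g
  rw [h, hq, map_mul, aeval_rename, Sum.elim_comp_inl, hx, zero_mul]

theorem minor_mem_segreIdeal (F : MvPolynomial (Fin (n + 1)) k) (i j : Fin (n + 1)) :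
    (X (i, 0) * X (j, 1) - X (i, 1) * X (j, 0) : MvPolynomial (Fin (n + 1) × Fin 2) k) ∈
      segreIdeal k n 1 (Ideal.span {F}) ⊥ := by
  rw [mem_segreIdeal_iff]
  convert Ideal.zero_mem _
  simp only [segreHom, map_sub, map_mul, aeval_X]
  ring

theorem rename_mem_segreIdeal {F : MvPolynomial (Fin (n + 1)) k} {d : ℕ} (hF : F.IsHomogeneous d)
    (s : Fin 2) : rename (fun i => (i, s)) F ∈ segreIdeal k n 1 (Ideal.span {F}) ⊥ := by
  rw [mem_segreIdeal_iff, segreHom, aeval_rename]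
  have h : (fun p : Fin (n + 1) × Fin 2 => (X (Sum.inl p.1) * X (Sum.inr p.2) :
      MvPolynomial (Fin (n + 1) ⊕ Fin 2) k)) ∘ (fun i => (i, s)) =
      fun i => X (Sum.inr s) * X (Sum.inl i) := funext fun i => mul_comm _ _
  rw [h, aeval_mul_of_isHomogeneous hF, ← Function.comp_def X, ← aeval_rename, aeval_X_left_apply]
  exact Ideal.mul_mem_left _ _ (Ideal.mem_span_singleton_self _)

/-- `2 * n - 1` generators up to radical of the ideal of the Segre product of a hypersurface with
`ℙ¹`. -/
noncomputable def segreGenerators (F : MvPolynomial (Fin (n + 1)) k) (i : Fin (2 * n - 1)) :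
    MvPolynomial (Fin (n + 1) × Fin 2) k :=
  if (i : ℕ) < 2 * n - 3 then minorSum (fun j => X (j, 0)) (fun j => X (j, 1)) (i + 1)
  else if (i : ℕ) = 2 * n - 3 then rename (fun j => (j, 0)) F else rename (fun j => (j, 1)) F

theorem isHomogeneous_minorSum (s : ℕ) :
    (minorSum (fun j => X (j, 0)) (fun j => X (j, 1)) s :
      MvPolynomial (Fin (n + 1) × Fin 2) k).IsHomogeneous 2 :=
  IsHomogeneous.sum _ _ _ fun _ _ =>
    ((isHomogeneous_X _ _).mul (isHomogeneous_X _ _)).sub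
      ((isHomogeneous_X _ _).mul (isHomogeneous_X _ _))

theorem exists_isHomogeneous_segreGenerators {F : MvPolynomial (Fin (n + 1)) k} {d : ℕ}
    (hF : F.IsHomogeneous d) (i : Fin (2 * n - 1)) :
    ∃ e, (segreGenerators F i).IsHomogeneous e := by
  unfold segreGenerators
  split_ifs
  · exact ⟨2, isHomogeneous_minorSum _⟩
  · exact ⟨d, hF.rename_isHomogeneous⟩
  · exact ⟨d, hF.rename_isHomogeneous⟩

theorem segreGenerators_mem {F : MvPolynomial (Fin (n + 1)) k} {d : ℕ}
    (hF : F.IsHomogeneous d) (i : Fin (2 * n - 1)) :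
    segreGenerators F i ∈ segreIdeal k n 1 (Ideal.span {F}) ⊥ := by
  unfold segreGenerators
  split_ifs
  · refine Ideal.sum_mem _ fun ij _ => ?_
    convert minor_mem_segreIdeal F ij.1 ij.2 using 1
    ring
  · exact rename_mem_segreIdeal hF 0
  · exact rename_mem_segreIdeal hF 1

/-- A point of the affine cone over the Segre variety lies over the cone over `V(F)` as soon as its
two rows do. -/
theorem aeval_eq_zero_of_mem_segreIdeal {K : Type*} [Field K] [Algebra k K]
    {F : MvPolynomial (Fin (n + 1)) k} {d : ℕ} (hF : F.IsHomogeneous d)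
    {w : Fin (n + 1) × Fin 2 → K} (hw : ∀ i j, w (i, 0) * w (j, 1) = w (j, 0) * w (i, 1))
    (h₀ : aeval (fun i => w (i, 0)) F = 0) (h₁ : aeval (fun i => w (i, 1)) F = 0)
    {g : MvPolynomial (Fin (n + 1) × Fin 2) k} (hg : g ∈ segreIdeal k n 1 (Ideal.span {F}) ⊥) :
    aeval w g = 0 := by
  by_cases h : ∀ i, w (i, 0) = 0
  · rw [show w = fun p => w (p.1, 1) * (![0, 1] : Fin 2 → K) p.2 from
      funext fun ⟨i, s⟩ => by fin_cases s <;> simp [h]]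
    exact map_segreHom_eq_zero h₁ hg
  · obtain ⟨a, ha⟩ := not_forall.mp h
    rw [show w = fun p => (w (p.1, 0) / w (a, 0)) * w (a, p.2) from funext fun ⟨i, s⟩ => by
      fin_cases s
      · simp [ha]
      · simp only [Fin.mk_one]
        rw [div_mul_eq_mul_div, hw, mul_div_cancel_left₀ _ ha]]
    refine map_segreHom_eq_zero (x := fun i => w (i, 0) / w (a, 0)) (y := fun s => w (a, s)) ?_ hg
    refine (mul_eq_zero_iff_left (pow_ne_zero d ha)).mp ?_
    rw [← aeval_mul_of_isHomogeneous hF, ← h₀]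
    congr 2
    exact funext fun i => mul_div_cancel₀ _ ha

variable {d : ℕ} {G : Fin (n - 2) → MvPolynomial (Fin (n + 1)) k}

theorem isHomogeneous_special (hd : 1 ≤ d) (hG : ∀ i, (G i).IsHomogeneous (d - 1))
    (e : Fin (n - 2) → Fin (n + 1)) :
    (X (Fin.last n) ^ d + ∑ i, X (e i) * G i : MvPolynomial (Fin (n + 1)) k).IsHomogeneous d := by
  refine (isHomogeneous_X_pow _ _).add (IsHomogeneous.sum _ _ _ fun i _ => ?_)
  simpa [Nat.add_sub_cancel' hd] using (isHomogeneous_X k (e i)).mul (hG i)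

theorem aeval_special_of_forall_eq_zero {A : Type*} [CommRing A] [Algebra k A]
    {x : Fin (n + 1) → A} (hx : ∀ i : Fin (n + 1), (i : ℕ) < n - 2 → x i = 0) :
    aeval x (X (Fin.last n) ^ d +
      ∑ i : Fin (n - 2), X (Fin.castLE ((Nat.sub_le n 2).trans n.le_succ) i) * G i :
      MvPolynomial (Fin (n + 1)) k) = x (Fin.last n) ^ d := by
  have h (i : Fin (n - 2)) : x (Fin.castLE ((Nat.sub_le n 2).trans n.le_succ) i) = 0 :=
    hx _ (by simp)
  simp [h]

theorem aeval_eq_zero_of_segreGenerators {K : Type*} [Field K] [Algebra k K] (hn : 2 ≤ n)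
    {F : MvPolynomial (Fin (n + 1)) k} (hhom : F.IsHomogeneous d)
    (hF : F = X (Fin.last n) ^ d +
      ∑ i : Fin (n - 2), X (Fin.castLE ((Nat.sub_le n 2).trans n.le_succ) i) * G i)
    {w : Fin (n + 1) × Fin 2 → K} (hw : ∀ i, aeval w (segreGenerators F i) = 0)
    {g : MvPolynomial (Fin (n + 1) × Fin 2) k} (hg : g ∈ segreIdeal k n 1 (Ideal.span {F}) ⊥) :
    aeval w g = 0 := by
  have h₀ : aeval (fun i => w (i, 0)) F = 0 := by
    have h := hw ⟨2 * n - 3, by omega⟩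
    rwa [segreGenerators, if_neg (lt_irrefl _), if_pos rfl, aeval_rename] at h
  have h₁ : aeval (fun i => w (i, 1)) F = 0 := by
    have h := hw ⟨2 * n - 2, by omega⟩
    rwa [segreGenerators, if_neg (by simp only; omega), if_neg (by simp only; omega),
      aeval_rename] at h
  refine aeval_eq_zero_of_mem_segreIdeal hhom (mul_eq_mul_of_minorSum_eq_zero hn
    (u := fun i => w (i, 0)) (v := fun i => w (i, 1)) (fun s hs₁ hs₂ => ?_) (fun hz => ?_)) h₀ h₁ hg
  · have h := hw ⟨s - 1, by omega⟩
    rw [segreGenerators, if_pos (by simp only; omega)] at h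
    simp only [Nat.sub_add_cancel hs₁] at h
    have hmap := map_minorSum (aeval w : MvPolynomial _ k →ₐ[k] K).toRingHom
      (fun j : Fin (n + 1) => X (j, 0)) (fun j => X (j, 1)) s
    simp only [AlgHom.toRingHom_eq_coe, RingHom.coe_coe, aeval_X] at hmap
    rw [← hmap, h]
  · rw [hF, aeval_special_of_forall_eq_zero fun i hi => (hz i hi).1] at h₀
    rw [hF, aeval_special_of_forall_eq_zero fun i hi => (hz i hi).2] at h₁
    exact ⟨eq_zero_of_pow_eq_zero h₀, eq_zero_of_pow_eq_zero h₁⟩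

theorem radical_span_segreGenerators (hn : 2 ≤ n) (hd : 1 ≤ d)
    (hG : ∀ i, (G i).IsHomogeneous (d - 1)) {F : MvPolynomial (Fin (n + 1)) k}
    (hF : F = X (Fin.last n) ^ d +
      ∑ i : Fin (n - 2), X (Fin.castLE ((Nat.sub_le n 2).trans n.le_succ) i) * G i) :
    (Ideal.span (Set.range (segreGenerators F))).radical =
      (segreIdeal k n 1 (Ideal.span {F}) ⊥).radical := by
  have hhom : F.IsHomogeneous d := hF ▸ isHomogeneous_special hd hG _
  refine le_antisymm (Ideal.radical_mono (Ideal.span_le.mpr ?_))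
    (Ideal.radical_le_radical_iff.mpr ?_)
  · rintro _ ⟨i, rfl⟩
    exact segreGenerators_mem hhom i
  rw [Ideal.radical_eq_sInf]
  refine le_sInf fun 𝔮 ⟨hle, hprime⟩ g hg => ?_
  have haeval (q : MvPolynomial (Fin (n + 1) × Fin 2) k) :
      aeval (fun p => algebraMap (MvPolynomial (Fin (n + 1) × Fin 2) k) 𝔮.ResidueField (X p)) q =
 algebraMap _ 𝔮.ResidueField q :=
    DFunLike.congr_fun (algHom_ext (g := IsScalarTower.toAlgHom k _ 𝔮.ResidueField)
      fun p => by simp) q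
  rw [← Ideal.algebraMap_residueField_eq_zero, ← haeval]
  refine aeval_eq_zero_of_segreGenerators hn hhom hF (fun i => ?_) hg
  rw [haeval, Ideal.algebraMap_residueField_eq_zero]
  exact hle (Ideal.subset_span ⟨i, rfl⟩)

theorem le_of_radical_span_eq (hn : 2 ≤ n) (hd : 1 ≤ d) {F : MvPolynomial (Fin (n + 1)) k}
    (hF : F = X (Fin.last n) ^ d +
      ∑ i : Fin (n - 2), X (Fin.castLE ((Nat.sub_le n 2).trans n.le_succ) i) * G i)
    {t : ℕ} {f : Fin t → MvPolynomial (Fin (n + 1) × Fin 2) k}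
    (hf : (Ideal.span (Set.range f)).radical = (segreIdeal k n 1 (Ideal.span {F}) ⊥).radical) :
    2 * n - 1 ≤ t := by
  by_contra! ht
  let c₀ : Fin (n + 1) := ⟨n - 2, by omega⟩
  let c₁ : Fin (n + 1) := ⟨n - 1, by omega⟩
  have hc : c₀ ≠ c₁ := by
    simp only [c₀, c₁, ne_eq, Fin.mk.injEq]
    omega
  refine not_forall_minor_mem_radical_span hc f (by omega) (fun l => ?_)
    fun i j => hf ▸ Ideal.le_radical (minor_mem_segreIdeal F i j)
  obtain ⟨m, hm⟩ : f l ∈ (segreIdeal k n 1 (Ideal.span {F}) ⊥).radical :=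
    hf ▸ Ideal.le_radical (Ideal.subset_span ⟨l, rfl⟩)
  let x : Fin (n + 1) → AddMonoidAlgebra k (ℤ × ℤ × ℤ) := fun i =>
    if i = c₀ then AddMonoidAlgebra.single (0, 0, 1) 1 else if i = c₁ then 1 else 0
  let y : Fin 2 → AddMonoidAlgebra k (ℤ × ℤ × ℤ) :=
    ![AddMonoidAlgebra.single (1, 0, 0) 1, AddMonoidAlgebra.single (0, 1, 0) 1]
  have hx : aeval x F = 0 := by
    have hlast : x (Fin.last n) = 0 := by
      rw [show x (Fin.last n) = _ from if_neg _, if_neg]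
      all_goals
        simp only [c₀, c₁, Fin.ext_iff, Fin.val_last]
        omega
    rw [hF, aeval_special_of_forall_eq_zero, hlast, zero_pow (by omega)]
    intro i hi
    rw [show x i = _ from if_neg _, if_neg]
    all_goals
      simp only [c₀, c₁, Fin.ext_iff]
      omega
  have hline (q) : lineEval k c₀ c₁ q =
      aeval (fun p : Fin (n + 1) × Fin 2 => x p.1 * y p.2) q := by
    refine congrArg (fun h : _ →+* _ => h q) (ringHom_ext (f := lineEval k c₀ c₁)
      (g := (aeval fun p : Fin (n + 1) × Fin 2 => x p.1 * y p.2).toRingHom) (fun a => ?_) ?_)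
    · simp [lineEval]
    · rintro ⟨i, s⟩
      rcases eq_or_ne i c₀ with rfl | h₀
      · fin_cases s <;>
          simp [lineEval, lineExp_apply, x, y, hc, hc.symm, AddMonoidAlgebra.single_mul_single]
      rcases eq_or_ne i c₁ with rfl | h₁
      · fin_cases s <;>
          simp [lineEval, lineExp_apply, x, y, hc, hc.symm]
      · simp [lineEval, x, h₀, h₁]
  refine eq_zero_of_pow_eq_zero (n := m) ?_
  rw [← map_pow, hline]
  exact map_segreHom_eq_zero hx hm

end Segre

theorem araH_eq_of_special_smooth_hypersurface_prod_P1
    (k : Type*) [Field k] (n d : ℕ) (hn : 2 ≤ n) (hd : 1 ≤ d)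
    (G : Fin (n-2) → MvPolynomial (Fin (n+1)) k)
    (hG : ∀ i, (G i).IsHomogeneous (d-1))
    (F : MvPolynomial (Fin (n+1)) k)
    (hF : F = X (Fin.last n) ^ d
      + ∑ i : Fin (n-2), X (Fin.castLE (by omega) i) * G i)
    (hsm : IsSmoothHypersurface F) :
    araH (segreIdeal k n 1 (Ideal.span {F}) ⊥) = 2*n - 1 ∧
    (CharZero k →
      ara (segreIdeal k n 1 (Ideal.span {F}) ⊥) = 2*n - 1 ∧
      ara (segreIdeal k n 1 (Ideal.span {F}) ⊥)
        = araH (segreIdeal k n 1 (Ideal.span {F}) ⊥)) := by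
  have hrad := radical_span_segreGenerators hn hd hG hF
  have hhom : F.IsHomogeneous d := hF ▸ isHomogeneous_special hd hG _
  have hara : ara (segreIdeal k n 1 (Ideal.span {F}) ⊥) = 2 * n - 1 :=
    IsLeast.csInf_eq ⟨⟨_, hrad⟩, fun _ ⟨_, hf⟩ => le_of_radical_span_eq hn hd hF hf⟩
  have haraH : araH (segreIdeal k n 1 (Ideal.span {F}) ⊥) = 2 * n - 1 :=
    IsLeast.csInf_eq ⟨⟨_, exists_isHomogeneous_segreGenerators hhom, hrad⟩,
      fun _ ⟨_, _, hf⟩ => le_of_radical_span_eq hn hd hF hf⟩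
  exact ⟨haraH, fun _ => ⟨hara, hara.trans haraH.symm⟩⟩
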